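/- arXiv:1604.05717 — 4 statements merged into one kernel-verified Lean document; each statement's English description precedes it below -/
import Mathlib

section
/- Let H be a complex Hilbert space, k a natural number with 0 < k < dim H, and let φ : B(H) → B(H) be a linear map that is positive (φ maps positive operators to positive operators), unital (φ(1) = 1), and maps the set of rank-k orthogonal projections in B(H) onto itself. Then either there exists a unitary operator U on H such that φ(a) = U a U* for all a ∈ B(H), or there exists an antiunitary operator (a surjective conjugate-linear isometry) J on H such that φ(a) = J a* J⁻¹ for all a ∈ B(H) (equivalently, φ(a) = U aᵗ U* for a unitary U, where aᵗ is the transpose with respect to a fixed orthonormal basis). -/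
variable {H : Type*} [NormedAddCommGroup H] [InnerProductSpace ℂ H] [CompleteSpace H]

/-- `P` is an orthogonal projection of rank `k` on `H`. -/
def IsRankProj (k : ℕ) (P : H →L[ℂ] H) : Prop :=
  IsSelfAdjoint P ∧ P * P = P ∧ Module.rank ℂ (LinearMap.range (P : H →ₗ[ℂ] H)) = k

namespace WRK

open InnerProductSpace ContinuousLinearMap
open scoped ComplexOrder

set_option linter.unusedSectionVars false
set_option linter.unusedSimpArgs false
set_option linter.unnecessarySimpa false

/-- Finite rank operators. -/
def FR (H : Type*) [NormedAddCommGroup H] [InnerProductSpace ℂ H] : Submodule ℂ (H →L[ℂ] H) :=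
  Submodule.span ℂ {a | ∃ x y : H, a = rankOne ℂ x y}

/-- The index set of a fixed Hilbert basis. -/
def bset (H : Type*) [NormedAddCommGroup H] [InnerProductSpace ℂ H] [CompleteSpace H] : Set H :=
  Classical.choose (exists_hilbertBasis ℂ H)

/-- A fixed Hilbert basis. -/
noncomputable def bas (H : Type*) [NormedAddCommGroup H] [InnerProductSpace ℂ H]
    [CompleteSpace H] : HilbertBasis (bset H) ℂ H :=
  Classical.choose (Classical.choose_spec (exists_hilbertBasis ℂ H))

/-- The trace. -/
noncomputable def tr (a : H →L[ℂ] H) : ℂ := ∑' i, inner ℂ (bas H i) (a (bas H i))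

theorem rk_mem (x y : H) : rankOne ℂ x y ∈ FR H := Submodule.subset_span ⟨x, y, rfl⟩

theorem hasSum_rk (x y : H) :
    HasSum (fun i => inner ℂ (bas H i) ((rankOne ℂ x y) (bas H i))) (inner ℂ y x) := by
  have := (bas H).hasSum_inner_mul_inner y x
  simpa [inner_smul_right] using this

theorem summable_of_mem {a : H →L[ℂ] H} (ha : a ∈ FR H) :
    Summable (fun i => inner ℂ (bas H i) (a (bas H i))) := by
  induction ha using Submodule.span_induction with
  | mem a h => obtain ⟨x, y, rfl⟩ := h; exact (hasSum_rk x y).summable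
  | zero => simpa using summable_zero
  | add a b _ _ h1 h2 => simpa [inner_add_right] using h1.add h2
  | smul c a _ h => simpa [inner_smul_right] using h.mul_left c

theorem tr_rk (x y : H) : tr (rankOne ℂ x y) = inner ℂ y x := (hasSum_rk x y).tsum_eq

theorem tr_add {a b : H →L[ℂ] H} (ha : a ∈ FR H) (hb : b ∈ FR H) : tr (a + b) = tr a + tr b := by
  unfold tr
  rw [← (summable_of_mem ha).tsum_add (summable_of_mem hb)]
  simp [inner_add_right]

theorem tr_smul (c : ℂ) (a : H →L[ℂ] H) : tr (c • a) = c * tr a := by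
  unfold tr
  rw [← tsum_mul_left]
  simp [inner_smul_right]

theorem tr_zero : tr (0 : H →L[ℂ] H) = 0 := by simp [tr]

theorem tr_sub {a b : H →L[ℂ] H} (ha : a ∈ FR H) (hb : b ∈ FR H) : tr (a - b) = tr a - tr b := by
  unfold tr
  rw [← (summable_of_mem ha).tsum_sub (summable_of_mem hb)]
  simp [inner_sub_right]

theorem tr_sum {ι : Type*} (s : Finset ι) (f : ι → H →L[ℂ] H) (hf : ∀ i ∈ s, f i ∈ FR H) :
    tr (∑ i ∈ s, f i) = ∑ i ∈ s, tr (f i) := by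
  classical
  induction s using Finset.induction_on with
  | empty => simp [tr_zero]
  | insert i s hi ih =>
    rw [Finset.sum_insert hi, Finset.sum_insert hi, tr_add, ih]
    · intro j hj; exact hf j (Finset.mem_insert_of_mem hj)
    · exact hf i (Finset.mem_insert_self _ _)
    · exact Submodule.sum_mem _ fun j hj => hf j (Finset.mem_insert_of_mem hj)

theorem mul_rk (a : H →L[ℂ] H) (x y : H) : a * rankOne ℂ x y = rankOne ℂ (a x) y := by
  ext z; simp

theorem rk_mul (a : H →L[ℂ] H) (x y : H) : rankOne ℂ x y * a = rankOne ℂ x (star a y) := by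
  ext z; simp [star_eq_adjoint, adjoint_inner_left]

theorem star_rk (x y : H) : star (rankOne ℂ x y) = rankOne ℂ y x := by
  simp [star_eq_adjoint]

theorem mul_mem_left (b : H →L[ℂ] H) {a : H →L[ℂ] H} (ha : a ∈ FR H) : b * a ∈ FR H := by
  induction ha using Submodule.span_induction with
  | mem a h => obtain ⟨x, y, rfl⟩ := h; rw [mul_rk]; exact rk_mem _ _
  | zero => simp
  | add a c _ _ h1 h2 => rw [mul_add]; exact add_mem h1 h2
  | smul c a _ h => rw [mul_smul_comm]; exact Submodule.smul_mem _ _ h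

theorem mul_mem_right (b : H →L[ℂ] H) {a : H →L[ℂ] H} (ha : a ∈ FR H) : a * b ∈ FR H := by
  induction ha using Submodule.span_induction with
  | mem a h => obtain ⟨x, y, rfl⟩ := h; rw [rk_mul]; exact rk_mem _ _
  | zero => simp
  | add a c _ _ h1 h2 => rw [add_mul]; exact add_mem h1 h2
  | smul c a _ h => rw [smul_mul_assoc]; exact Submodule.smul_mem _ _ h

theorem tr_mul_comm (b : H →L[ℂ] H) {a : H →L[ℂ] H} (ha : a ∈ FR H) : tr (b * a) = tr (a * b) := by
  induction ha using Submodule.span_induction with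
  | mem a h =>
    obtain ⟨x, y, rfl⟩ := h
    rw [mul_rk, rk_mul, tr_rk, tr_rk, star_eq_adjoint, adjoint_inner_left]
  | zero => simp
  | add a c ha hc h1 h2 =>
    rw [mul_add, add_mul, tr_add (mul_mem_left b ha) (mul_mem_left b hc),
      tr_add (mul_mem_right b ha) (mul_mem_right b hc), h1, h2]
  | smul c a _ h => rw [mul_smul_comm, smul_mul_assoc, tr_smul, tr_smul, h]

theorem pos_iff (a : H →L[ℂ] H) : 0 ≤ a ↔ ∀ x : H, 0 ≤ inner ℂ x (a x) := by
  rw [nonneg_iff_isPositive]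
  constructor
  · intro h x; exact h.inner_nonneg_right x
  · intro h
    rw [isPositive_iff_complex]
    intro x
    have := h x
    rw [← inner_conj_symm, ← Complex.star_def, star_nonneg_iff] at this
    obtain ⟨h1, h2⟩ := Complex.le_def.1 this
    refine ⟨?_, by simpa using h1⟩
    apply Complex.ext
    · simp
    · simpa using h2

theorem rk_nonneg (x : H) : 0 ≤ rankOne ℂ x x := by
  rw [nonneg_iff_isPositive]; simp

theorem tr_nonneg {a : H →L[ℂ] H} (h : 0 ≤ a) : 0 ≤ tr a :=
  tsum_nonneg fun i => (pos_iff a).1 h _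

theorem apply_eq_zero {a : H →L[ℂ] H} (h : 0 ≤ a) {x : H} (hx : inner ℂ x (a x) = 0) :
    a x = 0 := by
  obtain ⟨s, rfl⟩ := CStarAlgebra.nonneg_iff_eq_star_mul_self.1 h
  have : s x = 0 := by
    simpa [star_eq_adjoint, adjoint_inner_right] using hx
  simp [this]

theorem eq_zero_of_tr {a : H →L[ℂ] H} (ha : a ∈ FR H) (h : 0 ≤ a) (ht : tr a = 0) : a = 0 := by
  have h0 : HasSum (fun i => inner ℂ (bas H i) (a (bas H i))) 0 := by
    rw [← ht]; exact (summable_of_mem ha).hasSum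
  have h1 := (hasSum_zero_iff_of_nonneg (fun i => (pos_iff a).1 h (bas H i))).1 h0
  have h2 : ∀ i, a (bas H i) = 0 := fun i => apply_eq_zero h (congrFun h1 i)
  refine ContinuousLinearMap.ext_on (s := Set.range (bas H)) ?_ ?_
  · have := (bas H).dense_span
    rwa [← Submodule.dense_iff_topologicalClosure_eq_top] at this
  · rintro _ ⟨i, rfl⟩; simpa using h2 i

theorem le_iff (a b : H →L[ℂ] H) :
    a ≤ b ↔ ∀ x : H, inner ℂ x (a x) ≤ inner ℂ x (b x) := by
  rw [← sub_nonneg, pos_iff]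
  simp [inner_sub_right]



theorem proj_eq_sum {k : ℕ} {P : H →L[ℂ] H} (hP : IsRankProj k P) :
    ∃ v : Fin k → H, Orthonormal ℂ v ∧ P = ∑ i, rankOne ℂ (v i) (v i) := by
  obtain ⟨hsa, hid, hr⟩ := hP
  set R := LinearMap.range (P : H →ₗ[ℂ] H) with hR
  have hfr : Module.finrank ℂ R = k := Module.finrank_eq_of_rank_eq hr
  have : FiniteDimensional ℂ R := by
    rw [FiniteDimensional, ← Module.rank_lt_aleph0_iff, hr]; exact Cardinal.natCast_lt_aleph0
  let b := (stdOrthonormalBasis ℂ R).reindex (finCongr hfr)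
  have hfix : ∀ y ∈ R, P y = y := by
    rintro _ ⟨z, rfl⟩
    exact DFunLike.congr_fun hid z
  refine ⟨fun i => (b i : H), ?_, ?_⟩
  · exact b.orthonormal.comp_linearIsometry R.subtypeₗᵢ
  · ext z
    have h := congrArg (Subtype.val) (b.sum_repr' ⟨P z, ⟨z, rfl⟩⟩)
    simp only [_root_.sum_apply, rankOne_apply]
    rw [Submodule.coe_sum] at h
    refine h.symm.trans (Finset.sum_congr rfl fun i _ => ?_)
    simp only [Submodule.coe_smul, Submodule.coe_inner]
    congr 1
    have h2 : inner ℂ (P (b i : H)) z = inner ℂ (b i : H) (P z) := by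
      rw [← adjoint_inner_right, ← star_eq_adjoint, hsa.star_eq]
    rw [← h2, hfix _ (b i).2]

theorem sum_rk_apply {ι : Type*} [Fintype ι] (v : ι → H) (z : H) :
    (∑ i, rankOne ℂ (v i) (v i)) z = ∑ i, inner ℂ (v i) z • v i := by
  simp

theorem sum_rk_apply_self {ι : Type*} [Fintype ι] {v : ι → H} (hv : Orthonormal ℂ v) (j : ι) :
    (∑ i, rankOne ℂ (v i) (v i)) (v j) = v j := by
  classical
  rw [sum_rk_apply]
  simp [orthonormal_iff_ite.1 hv]

theorem isRankProj_sum {ι : Type*} [Fintype ι] {v : ι → H} (hv : Orthonormal ℂ v) :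
    IsRankProj (Fintype.card ι) (∑ i, rankOne ℂ (v i) (v i)) := by
  refine ⟨?_, ?_, ?_⟩
  · rw [IsSelfAdjoint, star_sum]
    simp [star_rk]
  · rw [Finset.mul_sum]
    refine Finset.sum_congr rfl fun j _ => ?_
    rw [mul_rk, sum_rk_apply_self hv]
  · have : LinearMap.range ((∑ i, rankOne ℂ (v i) (v i) : H →L[ℂ] H) : H →ₗ[ℂ] H)
        = Submodule.span ℂ (Set.range v) := by
      apply le_antisymm
      · rintro _ ⟨z, rfl⟩
        rw [ContinuousLinearMap.coe_coe, sum_rk_apply]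
        exact Submodule.sum_mem _ fun i _ => Submodule.smul_mem _ _
          (Submodule.subset_span ⟨i, rfl⟩)
      · rw [Submodule.span_le]
        rintro _ ⟨j, rfl⟩
        exact ⟨v j, sum_rk_apply_self hv j⟩
    have : FiniteDimensional ℂ (Submodule.span ℂ (Set.range v)) :=
      FiniteDimensional.span_of_finite ℂ (Set.finite_range v)
    rw [‹LinearMap.range _ = _›, ← Module.finrank_eq_rank, finrank_span_eq_card hv.linearIndependent]

theorem exists_onb {k : ℕ} (hkdim : (k : Cardinal) < Module.rank ℂ H) {x : H} (hx : ‖x‖ = 1) :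
    ∀ n ≤ k, ∃ v : Fin (n + 1) → H, Orthonormal ℂ v ∧ ∃ i, v i = x := by
  intro n
  induction n with
  | zero =>
    intro _
    refine ⟨fun _ => x, ?_, 0, rfl⟩
    constructor
    · intro _; exact hx
    · intro i j hij; exact absurd (Fin.ext (by omega)) hij
  | succ n ih =>
    intro hn
    obtain ⟨v, hv, i, hi⟩ := ih (by omega)
    set S := Submodule.span ℂ (Set.range v) with hS
    have : FiniteDimensional ℂ S := FiniteDimensional.span_of_finite ℂ (Set.finite_range v)
    have hrk : Module.rank ℂ S = ((n + 1 : ℕ) : Cardinal) := by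
      rw [← Module.finrank_eq_rank, finrank_span_eq_card hv.linearIndependent]
      simp
    have hne : S ≠ ⊤ := by
      intro h
      rw [h, rank_top] at hrk
      rw [hrk] at hkdim
      have : k < n + 1 := by exact_mod_cast hkdim
      omega
    have hbot : Sᗮ ≠ ⊥ := by
      intro h
      exact hne ((Submodule.orthogonal_eq_bot_iff).1 h)
    obtain ⟨w, hw, hw0⟩ := Submodule.exists_mem_ne_zero_of_ne_bot hbot
    refine ⟨Matrix.vecCons ((‖w‖⁻¹ : ℂ) • w) v, ?_, i.succ, by simpa using hi⟩
    rw [orthonormal_vecCons_iff]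
    refine ⟨?_, ?_, hv⟩
    · simp [norm_smul, hw0]
    · intro j
      rw [inner_smul_left]
      rw [Submodule.mem_orthogonal'] at hw
      rw [hw _ (Submodule.subset_span ⟨j, rfl⟩), mul_zero]

/-- Span of rank-`k` projections. -/
def SP (k : ℕ) (H : Type*) [NormedAddCommGroup H] [InnerProductSpace ℂ H] [CompleteSpace H] :
    Submodule ℂ (H →L[ℂ] H) := Submodule.span ℂ {P | IsRankProj k P}

theorem proj_mem {k : ℕ} {P : H →L[ℂ] H} (hP : IsRankProj k P) : P ∈ FR H := by
  obtain ⟨v, -, rfl⟩ := proj_eq_sum hP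
  exact Submodule.sum_mem _ fun i _ => rk_mem _ _

theorem proj_tr {k : ℕ} {P : H →L[ℂ] H} (hP : IsRankProj k P) : tr P = k := by
  obtain ⟨v, hv, rfl⟩ := proj_eq_sum hP
  rw [tr_sum _ _ fun i _ => rk_mem _ _]
  simp [tr_rk, hv.1]

theorem unit_mem_SP {k : ℕ} (hk : 0 < k) (hkdim : (k : Cardinal) < Module.rank ℂ H) {x : H}
    (hx : ‖x‖ = 1) : rankOne ℂ x x ∈ SP k H := by
  obtain ⟨v, hv, i, rfl⟩ := exists_onb hkdim hx k le_rfl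
  set S := ∑ i, rankOne ℂ (v i) (v i) with hS
  have hj : ∀ j, S - rankOne ℂ (v j) (v j) ∈ SP k H := by
    intro j
    apply Submodule.subset_span
    have h1 : Orthonormal ℂ (fun i : Fin k => v (j.succAbove i)) :=
      hv.comp _ Fin.succAbove_right_injective
    have h2 := isRankProj_sum h1
    rw [Fintype.card_fin] at h2
    have h3 : S - rankOne ℂ (v j) (v j)
        = ∑ i : Fin k, rankOne ℂ (v (j.succAbove i)) (v (j.succAbove i)) := by
      rw [hS, Fin.sum_univ_succAbove _ j]; abel
    rw [Set.mem_ofPred_eq, h3]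
    exact h2
  have hsum : ∑ j, (S - rankOne ℂ (v j) (v j)) = (k : ℂ) • S := by
    rw [Finset.sum_sub_distrib, ← hS]
    simp only [Finset.sum_const, Finset.card_univ, Fintype.card_fin]
    rw [← Nat.cast_smul_eq_nsmul ℂ]
    push_cast
    module
  have hSm : S ∈ SP k H := by
    have h : (k : ℂ) • S ∈ SP k H := by
      rw [← hsum]; exact Submodule.sum_mem _ fun j _ => hj j
    have hk' : (k : ℂ) ≠ 0 := by exact_mod_cast hk.ne'
    have := Submodule.smul_mem (SP k H) (k : ℂ)⁻¹ h
    rwa [smul_smul, inv_mul_cancel₀ hk', one_smul] at this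
  have := sub_mem hSm (hj i)
  simpa using this

theorem self_mem_SP {k : ℕ} (hk : 0 < k) (hkdim : (k : Cardinal) < Module.rank ℂ H) (x : H) :
    rankOne ℂ x x ∈ SP k H := by
  by_cases hx : x = 0
  · simp [hx]
  have h := unit_mem_SP hk hkdim (x := ((‖x‖⁻¹ : ℂ) • x)) (by simp [norm_smul, hx])
  have h2 := Submodule.smul_mem _ ((‖x‖ : ℂ) * ‖x‖) h
  have hx' : (‖x‖ : ℂ) ≠ 0 := by simpa using hx
  convert h2 using 1
  ext z
  simp [inner_smul_left, smul_smul]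
  congr 1
  field_simp

theorem polar (x y : H) : rankOne ℂ x y = (1 / 4 : ℂ) •
    (rankOne ℂ (x + y) (x + y) - rankOne ℂ (x - y) (x - y)
      + Complex.I • rankOne ℂ (x + Complex.I • y) (x + Complex.I • y)
      - Complex.I • rankOne ℂ (x - Complex.I • y) (x - Complex.I • y)) := by
  simp only [map_add, map_sub, _root_.add_apply, _root_.sub_apply,
    map_smulₛₗ, _root_.smul_apply, smul_add, smul_sub, smul_smul, Complex.conj_I,
    RingHom.id_apply]
  match_scalars <;> simp <;> ring_nf

theorem FR_eq_SP {k : ℕ} (hk : 0 < k) (hkdim : (k : Cardinal) < Module.rank ℂ H) :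
    FR H = SP k H := by
  apply le_antisymm
  · apply Submodule.span_le.2
    rintro _ ⟨x, y, rfl⟩
    rw [SetLike.mem_coe, polar]
    have h := self_mem_SP (H := H) hk hkdim
    exact Submodule.smul_mem _ _ (sub_mem (add_mem (sub_mem (h _) (h _))
      (Submodule.smul_mem _ _ (h _))) (Submodule.smul_mem _ _ (h _)))
  · apply Submodule.span_le.2
    intro P hP
    exact proj_mem hP

theorem FR_eq_self : FR H = Submodule.span ℂ {a | ∃ x : H, a = rankOne ℂ x x} := by
  apply le_antisymm
  · apply Submodule.span_le.2
    rintro _ ⟨x, y, rfl⟩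
    rw [SetLike.mem_coe, polar]
    have h : ∀ x : H, rankOne ℂ x x ∈ Submodule.span ℂ {a | ∃ x : H, a = rankOne ℂ x x} :=
      fun x => Submodule.subset_span ⟨x, rfl⟩
    exact Submodule.smul_mem _ _ (sub_mem (add_mem (sub_mem (h _) (h _))
      (Submodule.smul_mem _ _ (h _))) (Submodule.smul_mem _ _ (h _)))
  · apply Submodule.span_le.2
    rintro _ ⟨x, rfl⟩
    exact rk_mem _ _



theorem tr_proj_nonneg {Q A : H →L[ℂ] H} (hQ : Q ∈ FR H) (hs : star Q = Q) (hi : Q * Q = Q)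
    (hA : 0 ≤ A) : 0 ≤ tr (Q * A) := by
  have h1 : tr (Q * A) = tr (star Q * A * Q) := by
    rw [hs, mul_assoc, tr_mul_comm _ (mul_mem_left A hQ), mul_assoc, hi,
      tr_mul_comm _ hQ]
  rw [h1]
  exact tr_nonneg (star_left_conjugate_nonneg hA _)

theorem tr_proj_le {Q A : H →L[ℂ] H} (hs : star Q = Q) (hi : Q * Q = Q)
    (hA : 0 ≤ A) (hAF : A ∈ FR H) : tr (Q * A) ≤ tr A := by
  have h1 : tr A - tr (Q * A) = tr (star (1 - Q) * A * (1 - Q)) := by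
    rw [← tr_sub hAF (mul_mem_left Q hAF), star_sub, hs, star_one,
      ← tr_mul_comm _ (mul_mem_left _ hAF), ← mul_assoc]
    congr 1
    have : (1 - Q) * (1 - Q) = 1 - Q := by simp [mul_sub, sub_mul, hi]
    rw [this, sub_mul, one_mul]
  rw [← sub_nonneg, h1]
  exact tr_nonneg (star_left_conjugate_nonneg hA _)

theorem inner_proj {E : H →L[ℂ] H} (hs : star E = E) (hi : E * E = E) (w : H) :
    inner ℂ w (E w) = ((‖E w‖ ^ 2 : ℝ) : ℂ) := by
  have h : E w = E (E w) := (DFunLike.congr_fun hi w).symm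
  rw [h]
  nth_rewrite 1 [← hs]
  rw [star_eq_adjoint, adjoint_inner_right, inner_self_eq_norm_sq_to_K, ← h]
  simp

theorem rk_le_proj {E : H →L[ℂ] H} (hs : star E = E) (hi : E * E = E) {y : H} (hy : E y = y) :
    rankOne ℂ y y ≤ ((‖y‖ ^ 2 : ℝ) : ℂ) • E := by
  rw [le_iff]
  intro w
  have h1 : inner ℂ y w = inner ℂ y (E w) := by
    nth_rewrite 1 [← hy]
    rw [← adjoint_inner_right, ← star_eq_adjoint, hs]
  have h2 : inner ℂ w ((rankOne ℂ y y) w) = ((‖inner ℂ y (E w)‖ ^ 2 : ℝ) : ℂ) := by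
    rw [rankOne_apply, inner_smul_right, ← inner_conj_symm w y, h1, Complex.mul_conj,
      Complex.normSq_eq_norm_sq]
  rw [h2, _root_.smul_apply, inner_smul_right, inner_proj hs hi, ← Complex.ofReal_mul,
    Complex.real_le_real, ← mul_pow]
  exact pow_le_pow_left₀ (norm_nonneg _) (norm_inner_le_norm _ _) 2

/-- The hypotheses on `φ`. -/
structure Good (k : ℕ) (φ : (H →L[ℂ] H) →ₗ[ℂ] (H →L[ℂ] H)) : Prop where
  hk : 0 < k
  hkdim : (k : Cardinal) < Module.rank ℂ H
  pos : ∀ a, 0 ≤ a → 0 ≤ φ a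
  one : φ 1 = 1
  onto : φ '' {P | IsRankProj k P} = {P | IsRankProj k P}

/-- What we extract from the hypotheses. -/
structure Nice (φ : (H →L[ℂ] H) →ₗ[ℂ] (H →L[ℂ] H)) : Prop where
  pos : ∀ a, 0 ≤ a → 0 ≤ φ a
  one : φ 1 = 1
  map : ∀ a ∈ FR H, φ a ∈ FR H
  onto : ∀ b ∈ FR H, ∃ a ∈ FR H, φ a = b
  trace_eq : ∀ a ∈ FR H, tr (φ a) = tr a
  hs : ∀ a ∈ FR H, ∀ b ∈ FR H, tr (φ a * φ b) = tr (a * b)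

theorem Good.map_eq {k : ℕ} {φ : (H →L[ℂ] H) →ₗ[ℂ] (H →L[ℂ] H)} (h : Good k φ) :
    (FR H).map φ = FR H := by
  rw [FR_eq_SP h.hk h.hkdim, SP, Submodule.map_span, h.onto]

theorem Good.map_proj {k : ℕ} {φ : (H →L[ℂ] H) →ₗ[ℂ] (H →L[ℂ] H)} (h : Good k φ)
    {P : H →L[ℂ] H} (hP : IsRankProj k P) : IsRankProj k (φ P) := by
  have : φ P ∈ φ '' {P | IsRankProj k P} := ⟨P, hP, rfl⟩
  rw [h.onto] at this
  exact this

theorem Good.map_mem {k : ℕ} {φ : (H →L[ℂ] H) →ₗ[ℂ] (H →L[ℂ] H)} (h : Good k φ)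
    {a : H →L[ℂ] H} (ha : a ∈ FR H) : φ a ∈ FR H := by
  rw [← h.map_eq]; exact ⟨a, ha, rfl⟩

theorem Good.tr_eq {k : ℕ} {φ : (H →L[ℂ] H) →ₗ[ℂ] (H →L[ℂ] H)} (h : Good k φ)
    {a : H →L[ℂ] H} (ha : a ∈ FR H) : tr (φ a) = tr a := by
  have hle := (FR_eq_SP (H := H) h.hk h.hkdim)
  rw [hle] at ha
  unfold SP at ha
  induction ha using Submodule.span_induction with
  | mem P hP => rw [proj_tr hP, proj_tr (h.map_proj hP)]
  | zero => simp
  | add a b ha hb h1 h2 =>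
    change a ∈ SP k H at ha
    change b ∈ SP k H at hb
    rw [← hle] at ha hb
    rw [map_add, tr_add ha hb, tr_add (h.map_mem ha) (h.map_mem hb), h1, h2]
  | smul c a _ h => rw [map_smul, tr_smul, tr_smul, h]

theorem Good.key {k : ℕ} {φ : (H →L[ℂ] H) →ₗ[ℂ] (H →L[ℂ] H)} (h : Good k φ)
    {P : H →L[ℂ] H} (hP : IsRankProj k P) (z : H) :
    tr (φ P * φ (rankOne ℂ z z)) = tr (P * rankOne ℂ z z) := by
  have hQ := h.map_proj hP
  have hQF := proj_mem hQ
  have hPF := proj_mem hP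
  have hPs : star P = P := hP.1
  have hPi := hP.2.1
  have hQs : star (φ P) = φ P := hQ.1
  have hQi := hQ.2.1
  let ω : (H →L[ℂ] H) → ℂ := fun a => tr (φ P * φ a)
  have ωadd : ∀ a b, ω (a + b) = ω a + ω b := fun a b => by
    simp only [ω, map_add, mul_add]
    exact tr_add (mul_mem_right _ hQF) (mul_mem_right _ hQF)
  have ωsub : ∀ a b, ω (a - b) = ω a - ω b := fun a b => by
    simp only [ω, map_sub, mul_sub]
    exact tr_sub (mul_mem_right _ hQF) (mul_mem_right _ hQF)
  have ωsmul : ∀ (c : ℂ) a, ω (c • a) = c * ω a := fun c a => by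
    simp only [ω, map_smul, mul_smul_comm, tr_smul]
  have ωpos : ∀ a, 0 ≤ a → 0 ≤ ω a := fun a ha => tr_proj_nonneg hQF hQs hQi (h.pos a ha)
  have ωle : ∀ a, 0 ≤ a → a ∈ FR H → ω a ≤ tr a := fun a ha haF => by
    rw [← h.tr_eq haF]
    exact tr_proj_le hQs hQi (h.pos a ha) (h.map_mem haF)
  have ωP : ω P = k := by simp only [ω]; rw [hQi, proj_tr hQ]
  have ω1 : ω 1 = k := by simp only [ω]; rw [h.one, mul_one, proj_tr hQ]
  set x := P z with hx
  set y := z - P z with hy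
  have hPx : P x = x := DFunLike.congr_fun hPi z
  have hPy : (1 - P) y = y := by
    rw [_root_.sub_apply, hy, ← hx, map_sub P, hPx, ← hx]; simp
  have hyy : ω (rankOne ℂ y y) = 0 := by
    have h1 := rk_le_proj (E := 1 - P) (by rw [star_sub, hPs, star_one])
      (by simp [mul_sub, sub_mul, hPi]) hPy
    have h2 := ωpos _ (sub_nonneg.2 h1)
    rw [ωsub, ωsmul, ωsub, ω1, ωP, sub_self, mul_zero, zero_sub, neg_nonneg] at h2
    exact le_antisymm h2 (ωpos _ (rk_nonneg y))
  have hxx : ω (rankOne ℂ x x) = ((‖x‖ ^ 2 : ℝ) : ℂ) := by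
    apply le_antisymm
    · refine (ωle _ (rk_nonneg x) (rk_mem x x)).trans (le_of_eq ?_)
      rw [tr_rk, inner_self_eq_norm_sq_to_K]; simp
    · have h1 := rk_le_proj hPs hPi hPx
      have h3 : ((‖x‖ ^ 2 : ℝ) : ℂ) • P ∈ FR H := Submodule.smul_mem _ _ hPF
      have h2 := ωle _ (sub_nonneg.2 h1) (sub_mem h3 (rk_mem x x))
      rw [ωsub, ωsmul, ωP, tr_sub h3 (rk_mem x x), tr_smul, proj_tr hP, tr_rk,
        inner_self_eq_norm_sq_to_K, sub_le_sub_iff_left] at h2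
      simpa using h2
  set c := ω (rankOne ℂ x y + rankOne ℂ y x) with hc
  have hexp : ∀ s : ℝ, ω (rankOne ℂ (x + (s : ℂ) • y) (x + (s : ℂ) • y))
      = ((‖x‖ ^ 2 : ℝ) : ℂ) + s * c := by
    intro s
    have : rankOne ℂ (x + (s : ℂ) • y) (x + (s : ℂ) • y)
        = rankOne ℂ x x + (s : ℂ) • (rankOne ℂ x y + rankOne ℂ y x)
          + ((s : ℂ) * s) • rankOne ℂ y y := by
      simp only [map_add, _root_.add_apply, map_smulₛₗ, _root_.smul_apply, smul_smul,
        Complex.conj_ofReal, RingHom.id_apply]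
      module
    rw [this, ωadd, ωadd, ωsmul, ωsmul, hyy, hxx, mul_zero, add_zero]
  have hge : ∀ s : ℝ, 0 ≤ ((‖x‖ ^ 2 : ℝ) : ℂ) + s * c := by
    intro s; rw [← hexp]; exact ωpos _ (rk_nonneg _)
  have hcim : c.im = 0 := by
    have := (Complex.le_def.1 (hge 1)).2
    rw [Complex.add_im, Complex.ofReal_im, Complex.im_ofReal_mul] at this
    simpa using this.symm
  have hcre : c.re = 0 := by
    by_contra hne
    have := (Complex.le_def.1 (hge (-(‖x‖ ^ 2 + 1) / c.re))).1
    rw [Complex.add_re, Complex.re_ofReal_mul, Complex.ofReal_re, div_mul_cancel₀ _ hne] at this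
    simp at this
    linarith
  have hc0 : c = 0 := Complex.ext hcre hcim
  have hz : z = x + ((1 : ℝ) : ℂ) • y := by simp [hx, hy]
  have := hexp 1
  rw [← hz, hc0, mul_zero, add_zero] at this
  change ω (rankOne ℂ z z) = _
  rw [this, mul_rk, tr_rk, inner_proj hPs hPi]

theorem Good.nice {k : ℕ} {φ : (H →L[ℂ] H) →ₗ[ℂ] (H →L[ℂ] H)} (h : Good k φ) : Nice φ where
  pos := h.pos
  one := h.one
  map a ha := h.map_mem ha
  onto b hb := by
    rw [← h.map_eq] at hb
    exact hb
  trace_eq a ha := h.tr_eq ha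
  hs a ha b hb := by
    have hle := (FR_eq_SP (H := H) h.hk h.hkdim)
    have hb' := h.map_mem hb
    rw [hle] at ha
    unfold SP at ha
    induction ha using Submodule.span_induction with
    | mem P hP =>
      have hPF := proj_mem hP
      have hQF := proj_mem (h.map_proj hP)
      rw [FR_eq_self] at hb
      clear hb'
      induction hb using Submodule.span_induction with
      | mem b hb => obtain ⟨z, rfl⟩ := hb; exact h.key hP z
      | zero => simp
      | add a b _ _ h1 h2 =>
        rw [map_add, mul_add, mul_add, tr_add (mul_mem_right _ hPF) (mul_mem_right _ hPF),
          tr_add (mul_mem_right _ hQF) (mul_mem_right _ hQF), h1, h2]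
      | smul c a _ h => rw [map_smul, mul_smul_comm, mul_smul_comm, tr_smul, tr_smul, h]
    | zero => simp
    | add a c _ _ h1 h2 =>
      rw [map_add, add_mul, add_mul, tr_add (mul_mem_left _ hb) (mul_mem_left _ hb),
        tr_add (mul_mem_left _ hb') (mul_mem_left _ hb'), h1, h2]
    | smul c a _ h => rw [map_smul, smul_mul_assoc, smul_mul_assoc, tr_smul, tr_smul, h]



theorem star_map {φ : (H →L[ℂ] H) →ₗ[ℂ] (H →L[ℂ] H)} (hpos : ∀ a, 0 ≤ a → 0 ≤ φ a)
    (a : H →L[ℂ] H) : φ (star a) = star (φ a) := by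
  have ha : a ∈ Submodule.span ℂ {a : H →L[ℂ] H | 0 ≤ a} := by
    rw [CStarAlgebra.span_nonneg]; trivial
  induction ha using Submodule.span_induction with
  | mem a h =>
    have h : 0 ≤ a := h
    rw [(IsSelfAdjoint.of_nonneg h).star_eq, (IsSelfAdjoint.of_nonneg (hpos a h)).star_eq]
  | zero => simp
  | add a b _ _ h1 h2 => simp [h1, h2]
  | smul c a _ h => simp [h]

theorem rk_le_one {x : H} (hx : ‖x‖ = 1) : rankOne ℂ x x ≤ 1 := by
  simpa [hx] using rk_le_proj (E := (1 : H →L[ℂ] H)) (star_one _) (mul_one _) (y := x) rfl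

theorem Nice.idem {φ : (H →L[ℂ] H) →ₗ[ℂ] (H →L[ℂ] H)} (h : Nice φ) {x : H} (hx : ‖x‖ = 1) :
    φ (rankOne ℂ x x) * φ (rankOne ℂ x x) = φ (rankOne ℂ x x) := by
  set A := φ (rankOne ℂ x x) with hA
  have hAF : A ∈ FR H := h.map _ (rk_mem x x)
  have hA0 : 0 ≤ A := h.pos _ (rk_nonneg x)
  have hA1 : 0 ≤ 1 - A := by
    have := h.pos _ (sub_nonneg.2 (rk_le_one hx))
    rwa [map_sub, h.one] at this
  have hAs : star A = A := (IsSelfAdjoint.of_nonneg hA0).star_eq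
  have h1 : 0 ≤ A - A * A := by
    have h2 := star_left_conjugate_nonneg hA1 A
    have h3 := star_left_conjugate_nonneg hA0 (1 - A)
    rw [star_sub, star_one, hAs] at h3
    rw [hAs] at h2
    have h4 := add_nonneg h2 h3
    have : A * (1 - A) * A + (1 - A) * A * (1 - A) = A - A * A := by noncomm_ring
    rwa [this] at h4
  have h2 : tr (A - A * A) = 0 := by
    rw [tr_sub hAF (mul_mem_left _ hAF), hA, h.hs _ (rk_mem x x) _ (rk_mem x x),
      h.trace_eq _ (rk_mem x x), mul_rk, tr_rk, tr_rk]
    simp [inner_smul_right, hx]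
  exact (sub_eq_zero.1 (eq_zero_of_tr (sub_mem hAF (mul_mem_left _ hAF)) h1 h2)).symm

theorem Nice.exists_vec {φ : (H →L[ℂ] H) →ₗ[ℂ] (H →L[ℂ] H)} (h : Nice φ) {x : H} (hx : ‖x‖ = 1) :
    ∃ f : H, ‖f‖ = 1 ∧ φ (rankOne ℂ x x) = rankOne ℂ f f := by
  have hid := h.idem hx
  have htr : tr (φ (rankOne ℂ x x)) = 1 := by
    rw [h.trace_eq _ (rk_mem x x), tr_rk]; simp [hx]
  set A := φ (rankOne ℂ x x) with hA
  have hAF : A ∈ FR H := h.map _ (rk_mem x x)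
  have hA0 : 0 ≤ A := h.pos _ (rk_nonneg x)
  have hAs : star A = A := (IsSelfAdjoint.of_nonneg hA0).star_eq
  have hne : ∃ z, A z ≠ 0 := by
    by_contra! hcon
    have : A = 0 := by ext z; simpa using hcon z
    rw [this, tr_zero] at htr
    exact zero_ne_one htr
  obtain ⟨z, hz⟩ := hne
  have hf : A (((‖A z‖⁻¹ : ℂ)) • A z) = ((‖A z‖⁻¹ : ℂ)) • A z := by
    rw [map_smul]; congr 1; exact DFunLike.congr_fun hid z
  have hfn : ‖((‖A z‖⁻¹ : ℂ)) • A z‖ = 1 := by simp [norm_smul, hz]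
  set f := ((‖A z‖⁻¹ : ℂ)) • A z
  refine ⟨f, hfn, ?_⟩
  have h1 := rk_le_proj hAs hid hf
  rw [hfn] at h1
  simp only [one_pow, Complex.ofReal_one, one_smul] at h1
  refine sub_eq_zero.1 (eq_zero_of_tr (sub_mem hAF (rk_mem f f)) (sub_nonneg.2 h1) ?_)
  rw [tr_sub hAF (rk_mem f f), htr, tr_rk]
  simp [hfn]

theorem Nice.sq {φ : (H →L[ℂ] H) →ₗ[ℂ] (H →L[ℂ] H)} (h : Nice φ) (z : H) :
    φ (rankOne ℂ z z) * φ (rankOne ℂ z z) = ((‖z‖ ^ 2 : ℝ) : ℂ) • φ (rankOne ℂ z z) := by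
  by_cases hz : z = 0
  · simp [hz]
  have hz' : (‖z‖ : ℂ) ≠ 0 := by simpa using hz
  have h1 := h.idem (x := ((‖z‖⁻¹ : ℂ)) • z) (by simp [norm_smul, hz])
  simp only [map_smulₛₗ, _root_.smul_apply, smul_smul, RingHom.id_apply, smul_mul_assoc,
    mul_smul_comm] at h1
  have h2 := congrArg (fun a => ((‖z‖ : ℂ) ^ 4) • a) h1
  simp only [smul_smul] at h2
  rw [← one_smul ℂ (φ (rankOne ℂ z z) * φ (rankOne ℂ z z))]
  convert h2 using 2
  · simp; field_simp
  · simp; field_simp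

theorem alg_four {A : Type*} [Ring A] [Algebra ℂ A] (X B C : A) (n : ℂ)
    (h : ∀ w : ℂ, ‖w‖ = 1 → (X + w • B + (starRingEnd ℂ w) • C) * (X + w • B + (starRingEnd ℂ w) • C)
      = n • (X + w • B + (starRingEnd ℂ w) • C)) :
    B * B + C * C = 0 ∧ X * B + B * X = n • B ∧ X * X + B * C + C * B = n • X := by
  have h1 := h 1 (by simp)
  have h2 := h (-1) (by simp)
  have h3 := h Complex.I (by simp)
  have h4 := h (-Complex.I) (by simp)
  simp only [map_neg, map_one, Complex.conj_I, mul_add, add_mul, smul_mul_assoc, mul_smul_comm,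
    smul_smul, smul_add, neg_neg, neg_mul, mul_neg, Complex.I_mul_I, one_mul, mul_one] at h1 h2 h3 h4
  refine ⟨?_, ?_, ?_⟩
  · linear_combination (norm := skip) (1 / 4 : ℂ) • h1 + (1 / 4 : ℂ) • h2 - (1 / 4 : ℂ) • h3
      - (1 / 4 : ℂ) • h4
    match_scalars <;> ring_nf <;> simp
  · linear_combination (norm := skip) (1 / 4 : ℂ) • h1 - (1 / 4 : ℂ) • h2 - (Complex.I / 4 : ℂ) • h3
      + (Complex.I / 4 : ℂ) • h4
    match_scalars <;> ring_nf <;> simp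
  · linear_combination (norm := skip) (1 / 4 : ℂ) • h1 + (1 / 4 : ℂ) • h2 + (1 / 4 : ℂ) • h3
      + (1 / 4 : ℂ) • h4
    match_scalars <;> ring_nf <;> simp

theorem Nice.four {φ : (H →L[ℂ] H) →ₗ[ℂ] (H →L[ℂ] H)} (h : Nice φ) {e x : H} (he : ‖e‖ = 1)
    (hx : inner ℂ e x = 0) (w : ℂ) (hw : ‖w‖ = 1) :
    let X := φ (rankOne ℂ e e) + φ (rankOne ℂ x x)
    let B := φ (rankOne ℂ x e)
    let C := φ (rankOne ℂ e x)
    (X + w • B + (starRingEnd ℂ w) • C) * (X + w • B + (starRingEnd ℂ w) • C)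
      = (1 + ‖x‖ ^ 2 : ℂ) • (X + w • B + (starRingEnd ℂ w) • C) := by
  intro X B C
  have h1 := h.sq (e + w • x)
  have h2 : φ (rankOne ℂ (e + w • x) (e + w • x)) = X + w • B + (starRingEnd ℂ w) • C := by
    have : rankOne ℂ (e + w • x) (e + w • x) = rankOne ℂ e e + rankOne ℂ x x
        + w • rankOne ℂ x e + (starRingEnd ℂ w) • rankOne ℂ e x := by
      have hww : w * starRingEnd ℂ w = 1 := by
        rw [Complex.mul_conj, Complex.normSq_eq_norm_sq, hw]; simp
      simp only [map_add, _root_.add_apply, map_smulₛₗ, _root_.smul_apply, smul_smul,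
        RingHom.id_apply, smul_add, hww, mul_comm (starRingEnd ℂ w) w]
      module
    rw [this]
    simp [X, B, C]
  have h3 : ‖e + w • x‖ ^ 2 = 1 + ‖x‖ ^ 2 := by
    have := norm_add_sq_eq_norm_sq_add_norm_sq_of_inner_eq_zero e (w • x)
      (by rw [inner_smul_right, hx, mul_zero])
    rw [norm_smul, hw, he, one_mul] at this
    nlinarith
  rw [h2, h3] at h1
  rw [h1]
  push_cast
  rfl


theorem Nice.three {φ : (H →L[ℂ] H) →ₗ[ℂ] (H →L[ℂ] H)} (h : Nice φ) {e x : H} (he : ‖e‖ = 1)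
    (hx : inner ℂ e x = 0) :
    let X := φ (rankOne ℂ e e) + φ (rankOne ℂ x x)
    let B := φ (rankOne ℂ x e)
    let C := φ (rankOne ℂ e x)
    B * B + C * C = 0 ∧ X * B + B * X = (1 + ‖x‖ ^ 2 : ℂ) • B ∧
      X * X + B * C + C * B = (1 + ‖x‖ ^ 2 : ℂ) • X :=
  alg_four _ _ _ _ (h.four he hx)

theorem Nice.sq_zero {φ : (H →L[ℂ] H) →ₗ[ℂ] (H →L[ℂ] H)} (h : Nice φ) {e x : H} (he : ‖e‖ = 1)
    (hx : inner ℂ e x = 0) : φ (rankOne ℂ x e) * φ (rankOne ℂ x e) = 0 := by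
  have h1 := (h.three he hx).1
  have h2 := (h.three he (x := (1 + Complex.I) • x) (by rw [inner_smul_right, hx, mul_zero])).1
  simp only [map_smulₛₗ, _root_.smul_apply, smul_smul, RingHom.id_apply, smul_mul_assoc,
    mul_smul_comm, map_add, map_one, Complex.conj_I] at h1 h2
  linear_combination (norm := skip) (1 / 2 : ℂ) • h1 - (Complex.I / 4 : ℂ) • h2
  match_scalars <;> ring_nf <;> simp [pow_succ, Complex.I_mul_I]

theorem Nice.lin {φ : (H →L[ℂ] H) →ₗ[ℂ] (H →L[ℂ] H)} (h : Nice φ) {e x : H} (he : ‖e‖ = 1)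
    (hx : inner ℂ e x = 0) :
    φ (rankOne ℂ e e) * φ (rankOne ℂ x e) + φ (rankOne ℂ x e) * φ (rankOne ℂ e e)
      = φ (rankOne ℂ x e) := by
  have h1 := (h.three he hx).2.1
  have h2 := (h.three he (x := (2 : ℂ) • x) (by rw [inner_smul_right, hx, mul_zero])).2.1
  simp only [map_smulₛₗ, _root_.smul_apply, smul_smul, RingHom.id_apply, smul_mul_assoc,
    mul_smul_comm, map_add, map_one, norm_smul, mul_add, add_mul, Complex.conj_ofNat,
    Complex.ofReal_mul, RCLike.norm_ofNat, Complex.ofReal_ofNat] at h1 h2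
  linear_combination (norm := skip) (4 / 3 : ℂ) • h1 - (1 / 6 : ℂ) • h2
  match_scalars <;> ring_nf

theorem Nice.orth {φ : (H →L[ℂ] H) →ₗ[ℂ] (H →L[ℂ] H)} (h : Nice φ) {e x f : H}
    (hf : φ (rankOne ℂ e e) = rankOne ℂ f f)
    (hx : inner ℂ e x = 0) :
    φ (rankOne ℂ e e) * φ (rankOne ℂ x x) = 0 ∧ φ (rankOne ℂ x x) * φ (rankOne ℂ e e) = 0 := by
  have h1 := h.hs _ (rk_mem x x) _ (rk_mem e e)
  have hG := h.pos _ (rk_nonneg x)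
  have hGs : star (φ (rankOne ℂ x x)) = φ (rankOne ℂ x x) := (IsSelfAdjoint.of_nonneg hG).star_eq
  rw [hf, mul_rk, mul_rk, tr_rk, tr_rk, rankOne_apply, inner_smul_right, hx, mul_zero] at h1
  have h2 := apply_eq_zero hG h1
  constructor
  · rw [hf, rk_mul, hGs, h2]; simp
  · rw [hf, mul_rk, h2]; simp

theorem Nice.G_eq {φ : (H →L[ℂ] H) →ₗ[ℂ] (H →L[ℂ] H)} (h : Nice φ) {e x f : H} (he : ‖e‖ = 1)
    (hf : φ (rankOne ℂ e e) = rankOne ℂ f f)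
    (hx : inner ℂ e x = 0) :
    φ (rankOne ℂ x x) = φ (rankOne ℂ x e) * φ (rankOne ℂ e x)
      + φ (rankOne ℂ e x) * φ (rankOne ℂ x e) - (‖x‖ ^ 2 : ℂ) • φ (rankOne ℂ e e) := by
  have h1 := (h.three he hx).2.2
  obtain ⟨h2, h3⟩ := h.orth hf hx
  have h4 := h.sq x
  have h5 := h.idem he
  simp only [mul_add, add_mul, h2, h3, h4, h5, Complex.ofReal_pow] at h1
  linear_combination (norm := skip) - h1
  module

/-- Dichotomy for a single vector. -/
theorem Nice.dich {φ : (H →L[ℂ] H) →ₗ[ℂ] (H →L[ℂ] H)} (h : Nice φ) {e x f : H} (he : ‖e‖ = 1)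
    (hfn : ‖f‖ = 1) (hf : φ (rankOne ℂ e e) = rankOne ℂ f f) (hx : inner ℂ e x = 0) :
    φ (rankOne ℂ x e) = φ (rankOne ℂ x e) * rankOne ℂ f f ∨
    φ (rankOne ℂ x e) = rankOne ℂ f f * φ (rankOne ℂ x e) := by
  have h1 := h.lin he hx
  have h2 := h.sq_zero he hx
  rw [hf] at h1
  set B := φ (rankOne ℂ x e) with hB
  rw [mul_rk, rk_mul] at *
  set u := B f with hu
  set v := star B f with hv
  have hff : inner ℂ f f = (1 : ℂ) := by simp [hfn]
  have hBapp : ∀ z, B z = inner ℂ v z • f + inner ℂ f z • u := by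
    intro z; nth_rewrite 1 [← h1]; simp
  have hf0 : f ≠ 0 := by rintro rfl; simp at hfn
  have hvf : inner ℂ v f = 0 := by
    have := hBapp f
    rw [hff, one_smul, ← hu, right_eq_add, smul_eq_zero] at this
    exact this.resolve_right hf0
  have hfv : inner ℂ f v = 0 := by rw [← inner_conj_symm, hvf, map_zero]
  have h3 : B (B v) = 0 := DFunLike.congr_fun h2 v
  rw [hBapp v, hfv, zero_smul, add_zero, map_smul, ← hu, smul_eq_zero] at h3
  rcases h3 with h3 | h3
  · left
    have : v = 0 := by simpa using h3
    rw [← h1, this]; simp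
  · right
    rw [← h1, h3]; simp

theorem Nice.dich_all {φ : (H →L[ℂ] H) →ₗ[ℂ] (H →L[ℂ] H)} (h : Nice φ) {e f : H} (he : ‖e‖ = 1)
    (hfn : ‖f‖ = 1) (hf : φ (rankOne ℂ e e) = rankOne ℂ f f) :
    (∀ x, φ (rankOne ℂ x e) = φ (rankOne ℂ x e) * rankOne ℂ f f) ∨
    (∀ x, φ (rankOne ℂ x e) = rankOne ℂ f f * φ (rankOne ℂ x e)) := by
  have hEE : rankOne ℂ f f * rankOne ℂ f f = rankOne ℂ f f := by
    rw [mul_rk]; simp [hfn]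
  have key : ∀ x, φ (rankOne ℂ x e) = φ (rankOne ℂ x e) * rankOne ℂ f f ∨
      φ (rankOne ℂ x e) = rankOne ℂ f f * φ (rankOne ℂ x e) := by
    intro x
    have hx : inner ℂ e (x - inner ℂ e x • e) = 0 := by
      rw [inner_sub_right, inner_smul_right]; simp [he]
    have hd : φ (rankOne ℂ x e) = inner ℂ e x • rankOne ℂ f f
        + φ (rankOne ℂ (x - inner ℂ e x • e) e) := by
      rw [← hf]; simp
    rw [hd]
    rcases h.dich he hfn hf hx with h1 | h1
    · left
      nth_rewrite 1 [h1]
      rw [add_mul, smul_mul_assoc, hEE]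
    · right
      nth_rewrite 1 [h1]
      rw [mul_add, mul_smul_comm, hEE]
  by_contra! hcon
  obtain ⟨⟨a, ha⟩, ⟨b, hb⟩⟩ := hcon
  have ha' := (key a).resolve_left ha
  have hb' := (key b).resolve_right hb
  rcases key (a + b) with h1 | h1
  · apply ha
    simp only [map_add, _root_.add_apply, add_mul] at h1
    rw [← hb'] at h1
    exact add_right_cancel h1
  · apply hb
    simp only [map_add, _root_.add_apply, mul_add] at h1
    rw [← ha'] at h1
    exact add_left_cancel h1


theorem Nice.norm_sq {φ : (H →L[ℂ] H) →ₗ[ℂ] (H →L[ℂ] H)} (h : Nice φ) {e x : H} (he : ‖e‖ = 1) :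
    tr (φ (rankOne ℂ x e) * φ (rankOne ℂ e x)) = (‖x‖ ^ 2 : ℂ) := by
  rw [h.hs _ (rk_mem _ _) _ (rk_mem _ _), mul_rk, tr_rk]
  simp [he]

theorem Nice.star_B {φ : (H →L[ℂ] H) →ₗ[ℂ] (H →L[ℂ] H)} (h : Nice φ) (x y : H) :
    φ (rankOne ℂ y x) = star (φ (rankOne ℂ x y)) := by
  rw [← star_map h.pos, star_rk]

/-- Positive unital maps that agree on finite rank operators agree. -/
theorem ext_of_FR {φ ψ : (H →L[ℂ] H) →ₗ[ℂ] (H →L[ℂ] H)}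
    (hφ : ∀ a, 0 ≤ a → 0 ≤ φ a) (hφ1 : φ 1 = 1) (hψ : ∀ a, 0 ≤ a → 0 ≤ ψ a) (hψ1 : ψ 1 = 1)
    (hag : ∀ a ∈ FR H, φ a = ψ a)
    (hv : ∀ f : H, ‖f‖ = 1 → ∃ z : H, ‖z‖ = 1 ∧ φ (rankOne ℂ z z) = rankOne ℂ f f) :
    φ = ψ := by
  have hz0 : ∀ χ : (H →L[ℂ] H) →ₗ[ℂ] (H →L[ℂ] H), (∀ a, 0 ≤ a → 0 ≤ χ a) → χ 1 = 1 →
      ∀ z f : H, ‖z‖ = 1 → ‖f‖ = 1 → χ (rankOne ℂ z z) = rankOne ℂ f f → ∀ a, 0 ≤ a →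
      inner ℂ f (χ ((1 - rankOne ℂ z z) * a * (1 - rankOne ℂ z z)) f) = 0 := by
    intro χ hχ hχ1 z f hz hf hzf a ha
    set q := 1 - rankOne ℂ z z with hq
    have hqs : star q = q := by rw [hq, star_sub, star_one, star_rk]
    have hzz : rankOne ℂ z z * rankOne ℂ z z = rankOne ℂ z z := by rw [mul_rk]; simp [hz]
    have hqq : q * q = q := by simp [hq, mul_sub, sub_mul, hzz]
    clear_value q
    have h1 : 0 ≤ q * a * q := by
      have := star_left_conjugate_nonneg ha q
      rwa [hqs] at this
    have h2 : a ≤ algebraMap ℝ (H →L[ℂ] H) ‖a‖ :=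
      IsSelfAdjoint.le_algebraMap_norm_self (IsSelfAdjoint.of_nonneg ha)
    have h3 : 0 ≤ (‖a‖ : ℂ) • q - q * a * q := by
      have := star_left_conjugate_nonneg (sub_nonneg.2 h2) q
      rw [hqs, mul_sub, sub_mul] at this
      convert this using 2
      rw [Algebra.algebraMap_eq_smul_one, mul_smul_comm, mul_one, smul_mul_assoc, hqq]
      exact Complex.coe_smul _ _
    have h4 := (pos_iff _).1 (hχ _ h1) f
    have h5 := (pos_iff _).1 (hχ _ h3) f
    have h6 : (χ q) f = 0 := by
      rw [hq, map_sub, hχ1, hzf]; simp [hf]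
    rw [map_sub, map_smul, _root_.sub_apply, _root_.smul_apply, h6, smul_zero, zero_sub,
      inner_neg_right, neg_nonneg] at h5
    exact le_antisymm h5 h4
  have hunit : ∀ a, 0 ≤ a → ∀ f : H, ‖f‖ = 1 → inner ℂ f (φ a f) = inner ℂ f (ψ a f) := by
    intro a ha f hf
    obtain ⟨z, hz, hzf⟩ := hv f hf
    have hF : a - (1 - rankOne ℂ z z) * a * (1 - rankOne ℂ z z) ∈ FR H := by
      have : a - (1 - rankOne ℂ z z) * a * (1 - rankOne ℂ z z)
          = rankOne ℂ z z * a + a * rankOne ℂ z z - rankOne ℂ z z * (a * rankOne ℂ z z) := by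
        noncomm_ring
      rw [this]
      exact sub_mem (add_mem (mul_mem_right _ (rk_mem _ _)) (mul_mem_left _ (rk_mem _ _)))
        (mul_mem_right _ (rk_mem _ _))
    have h1 := hz0 φ hφ hφ1 z f hz hf hzf a ha
    have h2 := hz0 ψ hψ hψ1 z f hz hf ((hag _ (rk_mem _ _)).symm.trans hzf) a ha
    have h3 := hag _ hF
    have h4 := congrArg (fun T : H →L[ℂ] H => inner ℂ f (T f)) h3
    simp only [map_sub φ, map_sub ψ, _root_.sub_apply, inner_sub_right, h1, h2, sub_zero] at h4
    exact h4
  have hpos : ∀ a, 0 ≤ a → φ a = ψ a := by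
    intro a ha
    have : ((φ a : H →L[ℂ] H) : H →ₗ[ℂ] H) = (ψ a : H →L[ℂ] H) := by
      rw [← ext_inner_map]
      intro x
      by_cases hx : x = 0
      · simp [hx]
      have h1 := hunit a ha ((‖x‖⁻¹ : ℂ) • x) (by simp [norm_smul, hx])
      simp only [map_smul, inner_smul_left, inner_smul_right] at h1
      have hx' : (‖x‖ : ℂ) ≠ 0 := by simpa using hx
      have h2 : inner ℂ x (φ a x) = inner ℂ x (ψ a x) := by
        simpa [hx'] using h1
      have h3 := congrArg (starRingEnd ℂ) h2
      simpa using h3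
    exact ContinuousLinearMap.coe_injective this
  ext1 a
  have ha : a ∈ Submodule.span ℂ {a : H →L[ℂ] H | 0 ≤ a} := by
    rw [CStarAlgebra.span_nonneg]; trivial
  induction ha using Submodule.span_induction with
  | mem a h => exact hpos a h
  | zero => simp
  | add a b _ _ h1 h2 => simp [h1, h2]
  | smul c a _ h => simp [h]

theorem Nice.norm_of {φ : (H →L[ℂ] H) →ₗ[ℂ] (H →L[ℂ] H)} (h : Nice φ) {z f : H} (hf : ‖f‖ = 1)
    (hzf : φ (rankOne ℂ z z) = rankOne ℂ f f) : ‖z‖ = 1 := by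
  have h1 := h.trace_eq _ (rk_mem z z)
  rw [hzf, tr_rk, tr_rk, inner_self_eq_norm_sq_to_K, inner_self_eq_norm_sq_to_K, hf] at h1
  have h2 : (1 : ℝ) = ‖z‖ ^ 2 := by
    exact Complex.ofReal_injective (by simpa using h1)
  nlinarith [norm_nonneg z]

/-- If `φ (z z*) = (V z)(V z)*` for all `z`, then `V` hits everything. -/
theorem Nice.mem_of_range {φ : (H →L[ℂ] H) →ₗ[ℂ] (H →L[ℂ] H)} (h : Nice φ) (V : H → H)
    (S : Submodule ℂ H) (hS : ∀ z, V z ∈ S)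
    (hV : ∀ z, φ (rankOne ℂ z z) = rankOne ℂ (V z) (V z)) (y : H) : y ∈ S := by
  have key : ∀ a ∈ FR H, ∀ w, φ a w ∈ S := by
    intro a ha w
    rw [FR_eq_self] at ha
    induction ha using Submodule.span_induction with
    | mem a h => obtain ⟨z, rfl⟩ := h; rw [hV]; exact Submodule.smul_mem _ _ (hS z)
    | zero => simp
    | add a b _ _ h1 h2 => rw [map_add]; exact add_mem h1 h2
    | smul c a _ h => rw [map_smul]; exact Submodule.smul_mem _ _ h
  by_cases hy : y = 0
  · rw [hy]; exact zero_mem _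
  obtain ⟨a, ha, hay⟩ := h.onto _ (rk_mem y y)
  have h1 := key a ha y
  rw [hay, rankOne_apply] at h1
  exact (Submodule.smul_mem_iff _ (by simpa using hy)).1 h1

theorem final_linear {φ : (H →L[ℂ] H) →ₗ[ℂ] (H →L[ℂ] H)} (h : Nice φ) {e f : H} (he : ‖e‖ = 1)
    (hfn : ‖f‖ = 1) (hf : φ (rankOne ℂ e e) = rankOne ℂ f f)
    (hL : ∀ x, φ (rankOne ℂ x e) = φ (rankOne ℂ x e) * rankOne ℂ f f) :
    ∃ U : H →L[ℂ] H, U ∈ unitary (H →L[ℂ] H) ∧ ∀ a : H →L[ℂ] H, φ a = U * a * star U := by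
  let V : H →ₗ[ℂ] H :=
    { toFun := fun x => φ (rankOne ℂ x e) f
      map_add' := fun x y => by simp
      map_smul' := fun c x => by simp }
  have hB : ∀ x, φ (rankOne ℂ x e) = rankOne ℂ (V x) f := fun x => by rw [hL x, mul_rk]; rfl
  have hC : ∀ x, φ (rankOne ℂ e x) = rankOne ℂ f (V x) := fun x => by
    rw [h.star_B x e, hB, star_rk]
  have hVe : V e = f := by
    change φ (rankOne ℂ e e) f = f
    rw [hf]; simp [hfn]
  have hnorm : ∀ x, ‖V x‖ = ‖x‖ := by
    intro x
    have h1 := h.norm_sq (x := x) he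
    rw [hB, hC, mul_rk, tr_rk, rankOne_apply, inner_smul_right, inner_self_eq_norm_sq_to_K,
      inner_self_eq_norm_sq_to_K, hfn] at h1
    have h2 : ‖V x‖ ^ 2 = ‖x‖ ^ 2 := by
      simp only [RCLike.ofReal_one, one_pow, one_mul] at h1
      exact Complex.ofReal_injective (by simpa using h1)
    exact (pow_left_inj₀ (norm_nonneg _) (norm_nonneg _) two_ne_zero).1 h2
  have hG0 : ∀ x, inner ℂ e x = 0 → φ (rankOne ℂ x x) = rankOne ℂ (V x) (V x) := by
    intro x hx
    rw [h.G_eq he hf hx, hB, hC, hf, mul_rk, mul_rk]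
    simp [hfn, hnorm]
  have hG : ∀ z, φ (rankOne ℂ z z) = rankOne ℂ (V z) (V z) := by
    intro z
    have hx : inner ℂ e (z - inner ℂ e z • e) = 0 := by
      rw [inner_sub_right, inner_smul_right]; simp [he]
    have hz : z = inner ℂ e z • e + (z - inner ℂ e z • e) := by abel
    set x := z - inner ℂ e z • e
    set c := inner ℂ e z
    rw [hz]
    simp only [map_add, map_smulₛₗ, _root_.add_apply, _root_.smul_apply, hB, hC, hG0 x hx,
      hVe, RingHom.id_apply]
  let Vi : H →ₗᵢ[ℂ] H := ⟨V, hnorm⟩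
  have hsurj : Function.Surjective Vi := fun y =>
    h.mem_of_range V (LinearMap.range V) (fun z => ⟨z, rfl⟩) hG y
  let W := LinearIsometryEquiv.ofSurjective Vi hsurj
  let U : H →L[ℂ] H := (W : H ≃L[ℂ] H)
  have hUV : ∀ x, U x = V x := fun x => rfl
  have hU : U ∈ unitary (H →L[ℂ] H) := by
    rw [Unitary.mem_iff, star_eq_adjoint]
    have hadj : adjoint U = ((W.symm : H ≃L[ℂ] H) : H →L[ℂ] H) := W.adjoint_eq_symm
    rw [hadj]
    constructor
    · ext x; exact W.symm_apply_apply x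
    · ext x; exact W.apply_symm_apply x
  refine ⟨U, hU, ?_⟩
  let ψ : (H →L[ℂ] H) →ₗ[ℂ] (H →L[ℂ] H) :=
    { toFun := fun a => U * a * star U
      map_add' := fun a b => by rw [mul_add, add_mul]
      map_smul' := fun c a => by simp }
  have hag : ∀ a ∈ FR H, φ a = ψ a := by
    intro a ha
    rw [FR_eq_self] at ha
    induction ha using Submodule.span_induction with
    | mem a h =>
      obtain ⟨z, rfl⟩ := h
      change _ = U * rankOne ℂ z z * star U
      rw [hG, mul_rk, rk_mul, star_star, hUV]
    | zero => simp
    | add a b _ _ h1 h2 => rw [map_add, map_add, h1, h2]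
    | smul c a _ h => rw [map_smul, map_smul, h]
  have : φ = ψ := by
    refine ext_of_FR h.pos h.one (fun a ha => star_right_conjugate_nonneg ha U) ?_ hag ?_
    · change U * 1 * star U = 1
      rw [mul_one]; exact (Unitary.mem_iff.1 hU).2
    · intro g hg
      obtain ⟨z, hz⟩ := hsurj g
      have hz' : φ (rankOne ℂ z z) = rankOne ℂ g g := by rw [hG, ← hz]; rfl
      exact ⟨z, h.norm_of hg hz', hz'⟩
  intro a
  rw [this]; rfl

theorem final_conj {φ : (H →L[ℂ] H) →ₗ[ℂ] (H →L[ℂ] H)} (h : Nice φ) {e f : H} (he : ‖e‖ = 1)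
    (hfn : ‖f‖ = 1) (hf : φ (rankOne ℂ e e) = rankOne ℂ f f)
    (hR : ∀ x, φ (rankOne ℂ x e) = rankOne ℂ f f * φ (rankOne ℂ x e)) :
    ∃ J : H ≃ₗᵢ⋆[ℂ] H, ∀ (a : H →L[ℂ] H) (x : H), φ a x = J ((star a) (J.symm x)) := by
  let V : H →ₗ⋆[ℂ] H :=
    { toFun := fun x => φ (rankOne ℂ e x) f
      map_add' := fun x y => by simp
      map_smul' := fun c x => by simp }
  have hB : ∀ x, φ (rankOne ℂ x e) = rankOne ℂ f (V x) := fun x => by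
    rw [hR x, rk_mul, ← h.star_B]; rfl
  have hC : ∀ x, φ (rankOne ℂ e x) = rankOne ℂ (V x) f := fun x => by
    rw [h.star_B x e, hB, star_rk]
  have hVe : V e = f := by
    change φ (rankOne ℂ e e) f = f
    rw [hf]; simp [hfn]
  have hnorm : ∀ x, ‖V x‖ = ‖x‖ := by
    intro x
    have h1 := h.norm_sq (x := x) he
    rw [hB, hC, mul_rk, tr_rk, rankOne_apply, inner_smul_right, inner_self_eq_norm_sq_to_K,
      inner_self_eq_norm_sq_to_K, hfn] at h1
    have h2 : ‖V x‖ ^ 2 = ‖x‖ ^ 2 := by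
      simp only [RCLike.ofReal_one, one_pow, mul_one] at h1
      exact Complex.ofReal_injective (by simpa using h1)
    exact (pow_left_inj₀ (norm_nonneg _) (norm_nonneg _) two_ne_zero).1 h2
  have hG0 : ∀ x, inner ℂ e x = 0 → φ (rankOne ℂ x x) = rankOne ℂ (V x) (V x) := by
    intro x hx
    rw [h.G_eq he hf hx, hB, hC, hf, mul_rk, mul_rk]
    simp [hfn, hnorm]
  have hG : ∀ z, φ (rankOne ℂ z z) = rankOne ℂ (V z) (V z) := by
    intro z
    have hx : inner ℂ e (z - inner ℂ e z • e) = 0 := by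
      rw [inner_sub_right, inner_smul_right]; simp [he]
    have hz : z = inner ℂ e z • e + (z - inner ℂ e z • e) := by abel
    set x := z - inner ℂ e z • e
    set c := inner ℂ e z
    rw [hz]
    simp only [map_add, map_smulₛₗ, map_smul, _root_.add_apply, _root_.smul_apply, hB, hC, hG0 x hx,
      hVe, smul_smul, smul_add, RingHom.id_apply, Complex.conj_conj]
    module
  let Vi : H →ₛₗᵢ[starRingEnd ℂ] H := ⟨V, hnorm⟩
  have hsurj : Function.Surjective Vi := fun y =>
    h.mem_of_range V (LinearMap.range V) (fun z => ⟨z, rfl⟩) hG y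
  let J : H ≃ₗᵢ⋆[ℂ] H := LinearIsometryEquiv.ofSurjective Vi hsurj
  have hJV : ∀ x, J x = V x := fun x => rfl
  have hJinner : ∀ x y : H, inner ℂ (J x) y = inner ℂ (J.symm y) x := by
    intro x y
    obtain ⟨w, rfl⟩ := J.surjective y
    rw [J.symm_apply_apply, ← inner_conj_symm w x, inner_eq_sum_norm_sq_div_four,
      inner_eq_sum_norm_sq_div_four]
    have e1 : ‖J x + J w‖ = ‖x + w‖ := by rw [← map_add, J.norm_map]
    have e2 : ‖J x - J w‖ = ‖x - w‖ := by rw [← map_sub, J.norm_map]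
    have e3 : ‖J x - (RCLike.I : ℂ) • J w‖ = ‖x + (RCLike.I : ℂ) • w‖ := by
      rw [← J.norm_map (x + _), map_add, map_smulₛₗ]; simp [sub_eq_add_neg]
    have e4 : ‖J x + (RCLike.I : ℂ) • J w‖ = ‖x - (RCLike.I : ℂ) • w‖ := by
      rw [← J.norm_map (x - _), map_sub, map_smulₛₗ]; simp [sub_eq_add_neg]
    rw [e1, e2, e3, e4]
    have h4 : (starRingEnd ℂ) 4 = 4 := Complex.conj_ofNat 4
    simp [h4]
    ring
  let ψ : (H →L[ℂ] H) →ₗ[ℂ] (H →L[ℂ] H) :=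
    { toFun := fun a => (J : H →L⋆[ℂ] H).comp ((star a).comp (J.symm : H →L⋆[ℂ] H))
      map_add' := fun a b => by ext x; simp
      map_smul' := fun c a => by ext x; simp }
  have hψ : ∀ a x, ψ a x = J ((star a) (J.symm x)) := fun a x => rfl
  refine ⟨J, ?_⟩
  have hag : ∀ a ∈ FR H, φ a = ψ a := by
    intro a ha
    rw [FR_eq_self] at ha
    induction ha using Submodule.span_induction with
    | mem a h =>
      obtain ⟨z, rfl⟩ := h
      ext x
      rw [hψ, hG, star_rk, rankOne_apply, rankOne_apply, ← hJV, hJinner, map_smulₛₗ,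
        inner_conj_symm]
    | zero => simp
    | add a b _ _ h1 h2 => rw [map_add, map_add, h1, h2]
    | smul c a _ h => rw [map_smul, map_smul, h]
  have : φ = ψ := by
    refine ext_of_FR h.pos h.one (fun a ha => ?_) ?_ hag ?_
    · rw [pos_iff]
      intro x
      rw [hψ, (IsSelfAdjoint.of_nonneg ha).star_eq, ← inner_conj_symm, hJinner, ← Complex.star_def, star_nonneg_iff]
      exact (pos_iff a).1 ha _
    · ext x; rw [hψ]; simp
    · intro g hg
      obtain ⟨z, hz⟩ := hsurj g
      have hz' : φ (rankOne ℂ z z) = rankOne ℂ g g := by rw [hG, ← hz]; rfl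
      exact ⟨z, h.norm_of hg hz', hz'⟩
  intro a x
  rw [this]; rfl

end WRK

theorem wigner_rank_k
    (k : ℕ) (hk : 0 < k) (hkdim : (k : Cardinal) < Module.rank ℂ H)
    (φ : (H →L[ℂ] H) →ₗ[ℂ] (H →L[ℂ] H))
    (hpos : ∀ a : H →L[ℂ] H, a.IsPositive → (φ a).IsPositive)
    (hunital : φ 1 = 1)
    (honto : φ '' {P | IsRankProj k P} = {P | IsRankProj k P}) :
    (∃ U : H →L[ℂ] H, U ∈ unitary (H →L[ℂ] H) ∧
        ∀ a : H →L[ℂ] H, φ a = U * a * star U) ∨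
    (∃ J : H ≃ₗᵢ⋆[ℂ] H,
        ∀ (a : H →L[ℂ] H) (x : H), φ a x = J ((star a) (J.symm x))) := by
  have hg : WRK.Good k φ := ⟨hk, hkdim, fun a ha =>
    (ContinuousLinearMap.nonneg_iff_isPositive _).2
      (hpos a ((ContinuousLinearMap.nonneg_iff_isPositive _).1 ha)), hunital, honto⟩
  have hn := hg.nice
  have hx : ∃ x : H, x ≠ 0 := by
    by_contra hcon
    push Not at hcon
    have : Subsingleton H := ⟨fun a b => by rw [hcon a, hcon b]⟩
    rw [rank_subsingleton'] at hkdim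
    exact absurd hkdim (not_lt.2 zero_le)
  obtain ⟨x, hx⟩ := hx
  have he : ‖((‖x‖⁻¹ : ℂ) • x)‖ = 1 := by simp [norm_smul, hx]
  obtain ⟨f, hfn, hf⟩ := hn.exists_vec he
  rcases hn.dich_all he hfn hf with hL | hR
  · exact Or.inl (WRK.final_linear hn he hfn hf hL)
  · exact Or.inr (WRK.final_conj hn he hfn hf hR)
end

section
/- Let H be a complex Hilbert space, k a natural number with 0 < k < dim H, and let φ : B(H) → B(H) be a positive unital linear map which maps the set of rank-k orthogonal projections in B(H) onto itself. Then every rank-k projection Q lies in the definite set of φ, i.e. φ(Q²) = φ(Q)²; moreover every compact self-adjoint operator a ∈ B(H) lies in the definite set of φ, i.e. φ(a²) = φ(a)² for all compact self-adjoint a. -/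
variable {H : Type*} [NormedAddCommGroup H] [InnerProductSpace ℂ H] [CompleteSpace H]

lemma aux_kill {X R : H →L[ℂ] H} (hX : 0 ≤ X) (hR : IsSelfAdjoint R) (h : R * X * R = 0) :
    X * R = 0 := by
  have hs := CFC.sqrt_mul_sqrt_self X hX
  have hsa : IsSelfAdjoint (CFC.sqrt X) := (CFC.sqrt_nonneg X).isSelfAdjoint
  have : star (CFC.sqrt X * R) * (CFC.sqrt X * R) = 0 := by
    rw [star_mul, hsa.star_eq, hR.star_eq, ← h]
    conv_rhs => rw [← hs]
    simp only [mul_assoc]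
  rw [CStarRing.star_mul_self_eq_zero_iff] at this
  rw [← hs, mul_assoc, this, mul_zero]

lemma aux_sa (φ : (H →L[ℂ] H) →ₗ[ℂ] (H →L[ℂ] H))
    (hpos : ∀ a : H →L[ℂ] H, 0 ≤ a → 0 ≤ φ a) (hunital : φ 1 = 1)
    {b : H →L[ℂ] H} (hb : IsSelfAdjoint b) : IsSelfAdjoint (φ b) := by
  have h1 : 0 ≤ b + algebraMap ℝ _ ‖b‖ := by
    have := hb.neg_algebraMap_norm_le_self
    rw [neg_le_iff_add_nonneg] at this
    simpa [add_comm] using this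
  have h2 := (hpos _ h1).isSelfAdjoint
  have h3 : φ (algebraMap ℝ (H →L[ℂ] H) ‖b‖) = algebraMap ℝ (H →L[ℂ] H) ‖b‖ := by
    rw [Algebra.algebraMap_eq_smul_one, LinearMap.map_smul_of_tower, hunital]
  rw [map_add, h3] at h2
  have h4 : IsSelfAdjoint (algebraMap ℝ (H →L[ℂ] H) ‖b‖) := IsSelfAdjoint.algebraMap _ (.all _)
  simpa using h2.sub h4

/-- corner lemma for positive elements -/
lemma aux_corner_pos (φ : (H →L[ℂ] H) →ₗ[ℂ] (H →L[ℂ] H))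
    (hpos : ∀ a : H →L[ℂ] H, 0 ≤ a → 0 ≤ φ a)
    {Q : H →L[ℂ] H} (hQ : IsSelfAdjoint Q) (hQQ : Q * Q = Q)
    (hP : IsSelfAdjoint (φ Q)) (hPP : φ Q * φ Q = φ Q)
    {d : H →L[ℂ] H} (hd : 0 ≤ d) : φ (Q * d * Q) * (1 - φ Q) = 0 := by
  have h1 : 0 ≤ Q * d * Q := hQ.conjugate_nonneg hd
  have h2 : 0 ≤ ‖d‖ • Q - Q * d * Q := by
    have := hQ.conjugate_nonneg (sub_nonneg.2 hd.isSelfAdjoint.le_algebraMap_norm_self)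
    simpa [mul_sub, sub_mul, Algebra.algebraMap_eq_smul_one, hQQ] using this
  have h3 := hpos _ h1
  have h4 := hpos _ h2
  have hR : IsSelfAdjoint (1 - φ Q) := (IsSelfAdjoint.one _).sub hP
  refine aux_kill h3 hR (le_antisymm ?_ (hR.conjugate_nonneg h3))
  have h5 := hR.conjugate_nonneg h4
  have h6 : (1 - φ Q) * (φ Q) = 0 := by rw [sub_mul, hPP, one_mul, sub_self]
  have h7 : (1 - φ Q) * φ (‖d‖ • Q - Q * d * Q) * (1 - φ Q)
      = - ((1 - φ Q) * φ (Q * d * Q) * (1 - φ Q)) := by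
    rw [map_sub, LinearMap.map_smul_of_tower, mul_sub (1 - φ Q) (‖d‖ • φ Q), mul_smul_comm, h6,
      smul_zero, zero_sub, neg_mul]
  rw [h7] at h5
  exact neg_nonneg.1 h5

lemma aux_corner (φ : (H →L[ℂ] H) →ₗ[ℂ] (H →L[ℂ] H))
    (hpos : ∀ a : H →L[ℂ] H, 0 ≤ a → 0 ≤ φ a) 
    {Q : H →L[ℂ] H} (hQ : IsSelfAdjoint Q) (hQQ : Q * Q = Q)
    (hP : IsSelfAdjoint (φ Q)) (hPP : φ Q * φ Q = φ Q)
    {b : H →L[ℂ] H} (hb : IsSelfAdjoint b) : φ (Q * b * Q) * φ Q = φ (Q * b * Q) := by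
  have h1 : 0 ≤ b + algebraMap ℝ _ ‖b‖ := by
    have := hb.neg_algebraMap_norm_le_self
    rw [neg_le_iff_add_nonneg] at this
    simpa [add_comm] using this
  have h2 := aux_corner_pos φ hpos hQ hQQ hP hPP h1
  have h3 : (φ Q) * (1 - φ Q) = 0 := by rw [mul_sub, hPP, mul_one, sub_self]
  rw [mul_add, add_mul, map_add, add_mul, Algebra.algebraMap_eq_smul_one, mul_smul_comm,
    smul_mul_assoc, mul_one, hQQ, LinearMap.map_smul_of_tower, smul_mul_assoc, h3, smul_zero,
    add_zero, mul_sub, mul_one, sub_eq_zero] at h2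
  exact h2.symm

/-- off-diagonal part -/
lemma aux_off (φ : (H →L[ℂ] H) →ₗ[ℂ] (H →L[ℂ] H))
    (hpos : ∀ a : H →L[ℂ] H, 0 ≤ a → 0 ≤ φ a) (hunital : φ 1 = 1)
    {Q : H →L[ℂ] H} (hQ : IsSelfAdjoint Q) (hQQ : Q * Q = Q)
    (hP : IsSelfAdjoint (φ Q)) (hPP : φ Q * φ Q = φ Q)
    {b : H →L[ℂ] H} (hb : IsSelfAdjoint b) :
    φ Q * φ (Q * b * (1 - Q) + (1 - Q) * b * Q) * φ Q = 0 := by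
  set c := Q * b * (1 - Q) + (1 - Q) * b * Q with hc
  have hR : IsSelfAdjoint (1 - Q) := (IsSelfAdjoint.one _).sub hQ
  have hRR : (1 - Q) * (1 - Q) = 1 - Q := by
    simp [mul_sub, sub_mul, hQQ]
  have hQR : φ (1 - Q) = 1 - φ Q := by rw [map_sub, hunital]
  have hP' : IsSelfAdjoint (φ (1 - Q)) := by rw [hQR]; exact (IsSelfAdjoint.one _).sub hP
  have hPP' : φ (1 - Q) * φ (1 - Q) = φ (1 - Q) := by
    rw [hQR]; simp [mul_sub, sub_mul, hPP]
  have hbb : 0 ≤ b * b := by simpa [hb.star_eq] using star_mul_self_nonneg b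
  have hk := aux_corner_pos φ hpos hR hRR hP' hPP' hbb
  rw [hQR, sub_sub_cancel] at hk
  have key : ∀ t : ℝ, 0 ≤ (t * t) • φ Q + t • (φ Q * φ c * φ Q) := by
    intro t
    have h0 := star_mul_self_nonneg (t • Q + b * (1 - Q))
    have h1 : star (t • Q + b * (1 - Q)) * (t • Q + b * (1 - Q))
        = (t * t) • Q + t • c + (1 - Q) * (b * b) * (1 - Q) := by
      rw [star_add, star_mul, hb.star_eq, hR.star_eq, star_smul, hQ.star_eq, hc]
      simp only [star_trivial, add_mul, mul_add, smul_mul_assoc, mul_smul_comm, hQQ, smul_add,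
        smul_smul, mul_assoc]
      abel
    rw [h1] at h0
    have h2 := hP.conjugate_nonneg (hpos _ h0)
    rw [map_add, map_add, mul_add, add_mul, mul_assoc _ (φ ((1 - Q) * (b * b) * (1 - Q))), hk, 
      mul_zero, add_zero, LinearMap.map_smul_of_tower, LinearMap.map_smul_of_tower] at h2
    simpa only [mul_add, add_mul, mul_smul_comm, smul_mul_assoc, hPP] using h2
  have hcsa : IsSelfAdjoint c := by
    rw [IsSelfAdjoint, hc]
    simp only [star_add, star_mul, hb.star_eq, hR.star_eq, hQ.star_eq, mul_assoc]
    abel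
  have hcsa' := aux_sa φ hpos hunital hcsa
  set Y := φ Q * φ c * φ Q with hY
  have hYsa : IsSelfAdjoint Y := by
    rw [IsSelfAdjoint, hY]
    simp only [star_mul, hcsa'.star_eq, hP.star_eq, mul_assoc]
  have hY0 : ∀ x, inner ℂ (Y x) x = 0 := by
    intro x
    have hre : RCLike.re (inner ℂ (Y x) x) = 0 := by
      have : ∀ t : ℝ, 0 ≤ t * t * RCLike.re (inner ℂ (φ Q x) x)
          + t * RCLike.re (inner ℂ (Y x) x) := by
        intro t
        have := ((ContinuousLinearMap.nonneg_iff_isPositive _).1 (key t)).re_inner_nonneg_left x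
        have e : ∀ (r : ℝ) (y : H), RCLike.re (inner ℂ (r • y) x)
            = r * RCLike.re (inner ℂ y x) := by
          intro r y
          rw [← Complex.coe_smul, inner_smul_left]
          simp
        rw [ContinuousLinearMap.add_apply, inner_add_left, map_add,
          ContinuousLinearMap.smul_apply, ContinuousLinearMap.smul_apply, e, e] at this
        exact this
      generalize RCLike.re (inner ℂ (φ Q x) x) = p at this
      generalize RCLike.re (inner ℂ (Y x) x) = q at this
      by_contra hq
      have hp := this 1
      have hp' := this (-1)
      have hpp : 0 < 1 + 2 * p := by linarith
      have h3 := this (-q / (1 + 2 * p))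
      have h4 : (-q / (1 + 2 * p)) * (-q / (1 + 2 * p)) * p + (-q / (1 + 2 * p)) * q
        = - (q ^ 2) * (1 + p) / (1 + 2 * p) ^ 2 := by field_simp; ring
      rw [h4] at h3
      have : 0 < q ^ 2 * (1 + p) / (1 + 2 * p) ^ 2 := by
        have : 0 < 1 + p := by linarith
        positivity
      rw [neg_mul, neg_div] at h3
      linarith
    have him : RCLike.im (inner ℂ (Y x) x) = 0 :=
      (ContinuousLinearMap.isSelfAdjoint_iff_isSymmetric.1 hYsa).im_inner_apply_self x
    exact RCLike.ext (by simpa using hre) (by simpa using him)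
  ext x
  have := (inner_map_self_eq_zero (Y : H →ₗ[ℂ] H)).1 hY0
  exact congrArg (fun f => f x) this

lemma aux_key (φ : (H →L[ℂ] H) →ₗ[ℂ] (H →L[ℂ] H))
    (hpos : ∀ a : H →L[ℂ] H, 0 ≤ a → 0 ≤ φ a) (hunital : φ 1 = 1)
    {Q : H →L[ℂ] H} (hQ : IsSelfAdjoint Q) (hQQ : Q * Q = Q)
    (hP : IsSelfAdjoint (φ Q)) (hPP : φ Q * φ Q = φ Q)
    {b : H →L[ℂ] H} (hb : IsSelfAdjoint b) :
    φ (Q * b + b * Q) = φ Q * φ b + φ b * φ Q := by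
  have hR : IsSelfAdjoint (1 - Q) := (IsSelfAdjoint.one _).sub hQ
  have hRR : (1 - Q) * (1 - Q) = 1 - Q := by
    simp [mul_sub, sub_mul, hQQ]
  have hQR : φ (1 - Q) = 1 - φ Q := by rw [map_sub, hunital]
  have hP' : IsSelfAdjoint (φ (1 - Q)) := by rw [hQR]; exact (IsSelfAdjoint.one _).sub hP
  have hPP' : φ (1 - Q) * φ (1 - Q) = φ (1 - Q) := by
    rw [hQR]; simp [mul_sub, sub_mul, hPP]
  have o1 := aux_off φ hpos hunital hQ hQQ hP hPP hb
  have o2 := aux_off φ hpos hunital hR hRR hP' hPP' hb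
  have c1 := aux_corner φ hpos hQ hQQ hP hPP hb
  have c2 := aux_corner φ hpos hR hRR hP' hPP' hb
  have s1 : IsSelfAdjoint (φ (Q * b * Q)) := aux_sa φ hpos hunital (by
    simp only [IsSelfAdjoint, star_mul, hQ.star_eq, hb.star_eq, mul_assoc])
  have s2 : IsSelfAdjoint (φ ((1 - Q) * b * (1 - Q))) := aux_sa φ hpos hunital (by
    simp only [IsSelfAdjoint, star_mul, hR.star_eq, hb.star_eq, mul_assoc])
  have c1' := congrArg star c1
  have c2' := congrArg star c2
  rw [star_mul, s1.star_eq, hP.star_eq] at c1'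
  rw [star_mul, s2.star_eq, hP'.star_eq] at c2'
  rw [sub_sub_cancel, add_comm, hQR] at o2
  rw [hQR] at c2 c2'
  have e1 : b = Q * b * Q + (Q * b * (1 - Q) + (1 - Q) * b * Q) + (1 - Q) * b * (1 - Q) := by
    noncomm_ring
  have e2 : Q * b + b * Q = Q * b * Q + Q * b * Q + (Q * b * (1 - Q) + (1 - Q) * b * Q) := by
    noncomm_ring
  rw [e2]
  conv_rhs => rw [e1]
  simp only [map_add φ (_ + _) (_ * _ * (1 - Q)), map_add φ (Q * b * Q), 
    map_add φ (Q * b * Q + Q * b * Q)]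
  generalize φ (Q * b * (1 - Q) + (1 - Q) * b * Q) = Z at *
  generalize φ (Q * b * Q) = X at *
  generalize φ ((1 - Q) * b * (1 - Q)) = Y at *
  generalize φ Q = P at *
  have c3 : Y * P = 0 := by simpa [mul_sub] using c2
  have c3' : P * Y = 0 := by simpa [sub_mul] using c2'
  have o3 : Z = P * Z + Z * P := by
    have : Z - (P * Z + Z * P) = (1 - P) * Z * (1 - P) - P * Z * P := by noncomm_ring
    rw [o1, o2, sub_zero, sub_eq_zero] at this
    exact this
  simp only [mul_add, add_mul, c1, c1', c3, c3', add_zero]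
  conv_lhs => rw [o3]
  abel

open InnerProductSpace in
lemma aux_orthonormal {k : ℕ} {v : Fin k → H} (hv : Orthonormal ℂ v) :
    IsRankProj k (∑ i, rankOne ℂ (v i) (v i)) := by
  set P := ∑ i, rankOne ℂ (v i) (v i) with hP
  have hPx : ∀ x, P x = ∑ i, inner ℂ (v i) x • v i := by
    intro x; simp [hP, ContinuousLinearMap.sum_apply]
  have hPv : ∀ j, P (v j) = v j := by
    intro j
    rw [hPx]
    simp [orthonormal_iff_ite.1 hv]
  refine ⟨?_, ?_, ?_⟩
  · rw [hP]
    refine isSelfAdjoint_sum _ fun i _ => ?_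
    rw [IsSelfAdjoint, ContinuousLinearMap.star_eq_adjoint, adjoint_rankOne]
  · ext x
    rw [ContinuousLinearMap.mul_apply]
    conv_lhs => rw [hPx x]
    simp only [map_sum, map_smul, hPv]
    rw [hPx]
  · have : LinearMap.range (P : H →ₗ[ℂ] H) = Submodule.span ℂ (Set.range v) := by
      apply le_antisymm
      · rintro _ ⟨x, rfl⟩
        rw [ContinuousLinearMap.coe_coe, hPx]
        exact Submodule.sum_mem _ fun i _ =>
          Submodule.smul_mem _ _ (Submodule.subset_span ⟨i, rfl⟩)
      · rw [Submodule.span_le]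
        rintro _ ⟨i, rfl⟩
        exact ⟨v i, hPv i⟩
    rw [this, rank_span hv.linearIndependent]
    have h := Cardinal.mk_range_eq_of_injective hv.linearIndependent.injective
    simpa using h

lemma aux_extend {k : ℕ} (hkdim : (k : Cardinal) < Module.rank ℂ H) {x : H} (hx : ‖x‖ = 1) :
    ∃ v : Fin (k + 1) → H, Orthonormal ℂ v ∧ v 0 = x := by
  have hx0 : x ≠ 0 := by rintro rfl; simp at hx
  set K := Submodule.span ℂ {x} with hK
  have h1 : Module.rank ℂ H ≤ 1 + Module.rank ℂ Kᗮ := by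
    have := Submodule.rank_add_le_rank_add_rank K Kᗮ
    rw [Submodule.sup_orthogonal_of_hasOrthogonalProjection, rank_top] at this
    refine this.trans ?_
    gcongr
    simpa using rank_span_le (R := ℂ) {x}
  have h2 : (k : Cardinal) ≤ Module.rank ℂ Kᗮ := by
    by_contra h
    rw [not_le] at h
    obtain ⟨n, hn⟩ := Cardinal.lt_aleph0.1 (h.trans Cardinal.natCast_lt_aleph0)
    rw [hn] at h h1
    have h3 := hkdim.trans_le h1
    norm_cast at h h3
    omega
  obtain ⟨w, hw⟩ := Module.le_rank_iff.1 h2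
  have ho := InnerProductSpace.gramSchmidtNormed_orthonormal (𝕜 := ℂ) hw
  set u := InnerProductSpace.gramSchmidtNormed ℂ w
  have hux : ∀ i, inner ℂ x (u i : H) = 0 := fun i =>
    (Submodule.mem_orthogonal _ _).1 (u i).2 x (Submodule.mem_span_singleton_self x)
  have hux' : ∀ i, inner ℂ (u i : H) x = 0 := fun i => inner_eq_zero_symm.1 (hux i)
  rw [orthonormal_iff_ite] at ho
  refine ⟨Fin.cons x (fun i => (u i : H)), ?_, by simp⟩
  rw [orthonormal_iff_ite]
  intro i j
  refine Fin.cases ?_ (fun i => ?_) i <;> refine Fin.cases ?_ (fun j => ?_) j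
  · simp [inner_self_eq_norm_sq_to_K, hx]
  · simp [hux, (Fin.succ_ne_zero j).symm]
  · simp [hux', Fin.succ_ne_zero i]
  · simpa using ho i j

open InnerProductSpace in
lemma aux_rankOne_unit {k : ℕ} (hk : 0 < k) (hkdim : (k : Cardinal) < Module.rank ℂ H)
    {x : H} (hx : ‖x‖ = 1) :
    rankOne ℂ x x ∈ Submodule.span ℂ {P : H →L[ℂ] H | IsRankProj k P} := by
  obtain ⟨v, hv, rfl⟩ := aux_extend hkdim hx
  set f : Fin (k + 1) → (H →L[ℂ] H) := fun i => rankOne ℂ (v i) (v i) with hf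
  have h1 : ∀ p, ∑ i, f i - f p ∈ Submodule.span ℂ {P : H →L[ℂ] H | IsRankProj k P} := by
    intro p
    rw [Fin.sum_univ_succAbove f p, add_sub_cancel_left]
    exact Submodule.subset_span (aux_orthonormal (hv.comp _ (Fin.succAbove_right_injective (p := p))))
  have h2 : ∑ i, f i ∈ Submodule.span ℂ {P : H →L[ℂ] H | IsRankProj k P} := by
    have h3 := Submodule.sum_mem _ (fun p (_ : p ∈ Finset.univ) => h1 p)
    rw [Finset.sum_sub_distrib] at h3
    simp only [Finset.sum_const, Finset.card_univ, Fintype.card_fin, add_smul, one_smul,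
      add_sub_cancel_right] at h3
    have h4 := Submodule.smul_mem _ ((k : ℂ)⁻¹) h3
    rwa [← Nat.cast_smul_eq_nsmul ℂ, smul_smul, inv_mul_cancel₀ (by exact_mod_cast hk.ne'),
      one_smul] at h4
  simpa using Submodule.sub_mem _ h2 (h1 0)

open InnerProductSpace in
lemma aux_rankOne {k : ℕ} (hk : 0 < k) (hkdim : (k : Cardinal) < Module.rank ℂ H) (x y : H) :
    rankOne ℂ x y ∈ Submodule.span ℂ {P : H →L[ℂ] H | IsRankProj k P} := by
  have hd : ∀ x : H, rankOne ℂ x x ∈ Submodule.span ℂ {P : H →L[ℂ] H | IsRankProj k P} := by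
    intro x
    rcases eq_or_ne x 0 with rfl | hx
    · simp
    have h := aux_rankOne_unit hk hkdim (norm_smul_inv_norm (𝕜 := ℂ) hx)
    have h2 : rankOne ℂ x x = ((‖x‖ : ℂ) ^ 2) • rankOne ℂ (((‖x‖ : ℂ)⁻¹) • x) (((‖x‖ : ℂ)⁻¹) • x) := by
      have : (‖x‖ : ℂ) ≠ 0 := by simpa using hx
      simp only [map_smul, map_smulₛₗ, ContinuousLinearMap.smul_apply, smul_smul, map_inv₀,
        Complex.conj_ofReal]
      rw [show (‖x‖ : ℂ) ^ 2 * ((‖x‖ : ℂ)⁻¹ * (‖x‖ : ℂ)⁻¹) = 1 by field_simp, one_smul]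
    rw [h2]
    exact Submodule.smul_mem _ _ h
  have hp : rankOne ℂ x y = (4 : ℂ)⁻¹ • (rankOne ℂ (x + y) (x + y) - rankOne ℂ (x - y) (x - y)
      + Complex.I • rankOne ℂ (x + Complex.I • y) (x + Complex.I • y)
      - Complex.I • rankOne ℂ (x - Complex.I • y) (x - Complex.I • y)) := by
    rw [eq_inv_smul_iff₀ (by norm_num)]
    simp only [map_add, map_sub, map_smul, map_smulₛₗ, ContinuousLinearMap.smul_apply,
      ContinuousLinearMap.add_apply, ContinuousLinearMap.sub_apply, Complex.conj_I]
    match_scalars <;> ring_nf <;> simp <;> norm_num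
  rw [hp]
  refine Submodule.smul_mem _ _ (Submodule.sub_mem _ (Submodule.add_mem _ (Submodule.sub_mem _
    (hd _) (hd _)) (Submodule.smul_mem _ _ (hd _))) (Submodule.smul_mem _ _ (hd _)))

lemma aux_compact {k : ℕ} (hk : 0 < k) (hkdim : (k : Cardinal) < Module.rank ℂ H)
    {a : H →L[ℂ] H} (ha : IsCompactOperator a) :
    a ∈ closure (Submodule.span ℂ {P : H →L[ℂ] H | IsRankProj k P} : Set (H →L[ℂ] H)) := by
  rw [Metric.mem_closure_iff]
  intro ε hε
  have hc := IsCompactOperator.isCompact_closure_image_closedBall (f := (a : H →ₗ[ℂ] H)) ha 1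
  obtain ⟨t, -, htf, ht⟩ := Metric.finite_approx_of_totallyBounded hc.totallyBounded (ε / 2)
    (half_pos hε)
  set U := Submodule.span ℂ t
  haveI : FiniteDimensional ℂ U := FiniteDimensional.span_of_finite ℂ htf
  refine ⟨U.starProjection * a, ?_, ?_⟩
  · rw [(stdOrthonormalBasis ℂ U).starProjection_eq_sum_rankOne, Finset.sum_mul]
    refine Submodule.sum_mem _ fun i _ => ?_
    rw [ContinuousLinearMap.mul_def, InnerProductSpace.rankOne_comp]
    exact aux_rankOne hk hkdim _ _
  · rw [dist_eq_norm]
    refine lt_of_le_of_lt ?_ (half_lt_self hε)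
    refine ContinuousLinearMap.opNorm_le_of_unit_norm (half_pos hε).le fun x hx => ?_
    have hm : a x ∈ closure ((a : H →ₗ[ℂ] H) '' Metric.closedBall 0 1) :=
      subset_closure ⟨x, by simp [hx], rfl⟩
    obtain ⟨y, hy, hxy⟩ := Set.mem_iUnion₂.1 (ht hm)
    rw [ContinuousLinearMap.sub_apply, ContinuousLinearMap.mul_apply,
      Submodule.starProjection_minimal]
    refine (ciInf_le ⟨0, ?_⟩ (⟨y, Submodule.subset_span hy⟩ : U)).trans ?_
    · rintro _ ⟨z, rfl⟩; positivity
    · rw [Metric.mem_ball, dist_eq_norm] at hxy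
      exact hxy.le

theorem definite_set_contains_compacts
    (k : ℕ) (hk : 0 < k) (hkdim : (k : Cardinal) < Module.rank ℂ H)
    (φ : (H →L[ℂ] H) →ₗ[ℂ] (H →L[ℂ] H))
    (hpos : ∀ a : H →L[ℂ] H, a.IsPositive → (φ a).IsPositive)
    (hunital : φ 1 = 1)
    (honto : φ '' {P | IsRankProj k P} = {P | IsRankProj k P}) :
    (∀ Q : H →L[ℂ] H, IsRankProj k Q → φ (Q * Q) = φ Q * φ Q) ∧
    (∀ a : H →L[ℂ] H, IsCompactOperator a → IsSelfAdjoint a →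
      φ (a * a) = φ a * φ a) := by
  have hpos' : ∀ a : H →L[ℂ] H, 0 ≤ a → 0 ≤ φ a := fun a ha =>
    (ContinuousLinearMap.nonneg_iff_isPositive _).2
      (hpos a ((ContinuousLinearMap.nonneg_iff_isPositive _).1 ha))
  have hmap : ∀ Q : H →L[ℂ] H, IsRankProj k Q → IsRankProj k (φ Q) := by
    intro Q hQ
    have : φ Q ∈ φ '' {P | IsRankProj k P} := ⟨Q, hQ, rfl⟩
    rw [honto] at this
    exact this
  refine ⟨fun Q hQ => by rw [hQ.2.1, (hmap Q hQ).2.1], ?_⟩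
  intro a hac ha
  have hcont : Continuous φ := by
    have hb : ∃ C : ℝ, ∀ a, ‖φ a‖ ≤ C * ‖a‖ := by
      obtain ⟨C, h⟩ := PositiveLinearMap.exists_norm_apply_le (PositiveLinearMap.mk₀ φ hpos')
      exact ⟨C, h⟩
    exact (LinearMap.mkContinuousOfExistsBound φ hb).continuous
  have hclosed : IsClosed {c : H →L[ℂ] H | φ (c * a + a * c) = φ c * φ a + φ a * φ c} :=
    isClosed_eq (by fun_prop) (by fun_prop)
  have hsub : (Submodule.span ℂ {P : H →L[ℂ] H | IsRankProj k P} : Set (H →L[ℂ] H)) ⊆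
      {c : H →L[ℂ] H | φ (c * a + a * c) = φ c * φ a + φ a * φ c} := by
    intro c hc
    induction hc using Submodule.span_induction with
    | mem Q hQ =>
      have hQ' := hmap Q hQ
      exact aux_key φ hpos' hunital hQ.1 hQ.2.1 hQ'.1 hQ'.2.1 ha
    | zero => simp
    | add x y _ _ hx hy =>
      simp only [Set.mem_setOf_eq] at hx hy ⊢
      have : (x + y) * a + a * (x + y) = (x * a + a * x) + (y * a + a * y) := by noncomm_ring
      rw [this, map_add, hx, hy, map_add]
      noncomm_ring
    | smul r x _ hx =>
      simp only [Set.mem_setOf_eq] at hx ⊢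
      rw [smul_mul_assoc, mul_smul_comm, ← smul_add, map_smul, hx, map_smul, smul_mul_assoc,
        mul_smul_comm, smul_add]
  have hfin := closure_minimal hsub hclosed (aux_compact hk hkdim hac)
  simp only [Set.mem_setOf_eq, ← two_smul ℂ (_ * _ : H →L[ℂ] H), map_smul] at hfin
  exact smul_right_injective _ (two_ne_zero (α := ℂ)) hfin
end

section
/- Let H be a complex Hilbert space, k a natural number with 0 < k < dim H, and let φ : B(H) → B(H) be a positive unital linear map which maps the set of rank-k orthogonal projections in B(H) onto itself. Then φ maps the compact operators C(H) into C(H), and the restriction of φ to C(H) is either a *-automorphism or a *-anti-automorphism of C(H) (i.e., a bijective linear map preserving adjoints that is either multiplicative or anti-multiplicative). -/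
variable {H : Type*} [NormedAddCommGroup H] [InnerProductSpace ℂ H] [CompleteSpace H]

open InnerProductSpace in
theorem aux_sum_isRankProj (s : Finset H) (hs : Orthonormal ℂ ((↑) : s → H)) :
    IsRankProj s.card (∑ w ∈ s, rankOne ℂ w w) := by
  classical
  let b := OrthonormalBasis.span (𝕜 := ℂ) hs Finset.univ
  have hb : ∀ i, (b i : H) = i := fun i => OrthonormalBasis.span_apply hs Finset.univ i
  have e := b.starProjection_eq_sum_rankOne
  have e2 : (∑ w ∈ s, rankOne ℂ w w) = (Submodule.span ℂ
      ((Finset.univ : Finset s).image ((↑) : s → H) : Set H)).starProjection := by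
    rw [e]
    simp only [hb]
    rw [Finset.sum_coe_sort Finset.univ (fun w : s => rankOne ℂ (w : H) (w : H)),
      Finset.sum_coe_sort s (fun w => rankOne ℂ w w)]
  rw [e2]
  refine ⟨isSelfAdjoint_starProjection _, Submodule.isIdempotentElem_starProjection _, ?_⟩
  rw [Submodule.range_starProjection, rank_eq_card_basis b.toBasis]
  simp

theorem aux_exists_finset (k : ℕ) (hkdim : (k : Cardinal) < Module.rank ℂ H) (u : H) (hu : ‖u‖ = 1) :
    ∃ s : Finset H, u ∈ s ∧ Orthonormal ℂ ((↑) : s → H) ∧ s.card = k + 1 := by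
  classical
  have h0 : Orthonormal ℂ ((↑) : ({u} : Set H) → H) := by
    rw [orthonormal_subtype_iff_ite]
    intro v hv w hw
    rw [Set.mem_singleton_iff] at hv hw
    subst hv; subst hw; simp [hu]
  obtain ⟨w, b, huw, hb⟩ := h0.exists_hilbertBasis_extension
  have hw : Orthonormal ℂ ((↑) : w → H) := hb ▸ b.orthonormal
  have huw' : u ∈ w := huw rfl
  have hcard : ((k + 1 : ℕ) : ℕ∞) ≤ w.encard := by
    by_contra hlt
    rw [not_le] at hlt
    have hfin : w.Finite := Set.finite_of_encard_le_coe hlt.le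
    have hd := b.dense_span
    rw [hb, Subtype.range_coe] at hd
    have : FiniteDimensional ℂ (Submodule.span ℂ w) := FiniteDimensional.span_of_finite ℂ hfin
    rw [(Submodule.closed_of_finiteDimensional (Submodule.span ℂ w)).submodule_topologicalClosure_eq] at hd
    have h1 : Module.rank ℂ (Submodule.span ℂ w) ≤ Cardinal.mk w := rank_span_le w
    rw [hd, rank_top] at h1
    have h2 := hkdim.trans_le h1
    have := hfin.fintype
    rw [Cardinal.mk_fintype] at h2
    rw [Set.encard_eq_coe_toFinset_card] at hlt
    have h3 : k < Fintype.card w := by exact_mod_cast h2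
    have h4 : w.toFinset.card < k + 1 := by exact_mod_cast hlt
    rw [Set.toFinset_card] at h4
    omega
  obtain ⟨t, h1, h2, h3⟩ := Set.exists_superset_subset_encard_eq (s := {u}) (t := w) (k := ((k+1 : ℕ) : ℕ∞))
    (by simpa using huw') (by simp) hcard
  have hfin : t.Finite := Set.finite_of_encard_eq_coe h3
  refine ⟨hfin.toFinset, by simpa using h1, ?_, ?_⟩
  · have := hw.comp (fun x : hfin.toFinset => (⟨x, h2 (hfin.mem_toFinset.mp x.2)⟩ : w)) (by
      intro x y hxy; ext; simpa using hxy)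
    exact this
  · rw [hfin.encard_eq_coe_toFinset_card] at h3
    exact_mod_cast h3

/-- span of rank-`k` projections -/
def auxW (H : Type*) [NormedAddCommGroup H] [InnerProductSpace ℂ H] [CompleteSpace H] (k : ℕ) :
    Submodule ℂ (H →L[ℂ] H) := Submodule.span ℂ {P | IsRankProj k P}

open InnerProductSpace in
theorem aux_rankOne_mem (k : ℕ) (hk : 0 < k) (hkdim : (k : Cardinal) < Module.rank ℂ H) (x y : H) :
    rankOne ℂ x y ∈ auxW H k := by
  classical
  have h1 : ∀ u : H, ‖u‖ = 1 → rankOne ℂ u u ∈ auxW H k := by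
    intro u hu
    obtain ⟨s, hus, hs, hc⟩ := aux_exists_finset k hkdim u hu
    have hP : ∀ v ∈ s, ∑ w ∈ s.erase v, rankOne ℂ w w ∈ auxW H k := by
      intro v hv
      refine Submodule.subset_span ?_
      have := aux_sum_isRankProj (s.erase v)
        (hs.comp (fun x : s.erase v => (⟨x, Finset.mem_of_mem_erase x.2⟩ : s)) (by
          intro x y hxy; ext; simpa using hxy))
      rwa [Finset.card_erase_of_mem hv, hc, Nat.add_sub_cancel] at this
    have hT : (k : ℂ) • ∑ w ∈ s, rankOne ℂ w w ∈ auxW H k := by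
      have := Submodule.sum_mem _ hP
      have e : ∑ v ∈ s, ∑ w ∈ s.erase v, rankOne ℂ w w = (k : ℂ) • ∑ w ∈ s, rankOne ℂ w w := by
        have : ∀ v ∈ s, ∑ w ∈ s.erase v, rankOne ℂ w w = ∑ w ∈ s, rankOne ℂ w w - rankOne ℂ v v := by
          intro v hv
          rw [← Finset.add_sum_erase s _ hv]; abel
        rw [Finset.sum_congr rfl this, Finset.sum_sub_distrib, Finset.sum_const, hc, add_smul, one_smul, add_sub_cancel_right]
        exact (Nat.cast_smul_eq_nsmul ℂ k _).symm
      rwa [e] at this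
    have hT' := (Submodule.smul_mem_iff _ (Nat.cast_ne_zero.mpr hk.ne' : (k : ℂ) ≠ 0)).mp hT
    have := Submodule.sub_mem _ hT' (hP u hus)
    rwa [← Finset.add_sum_erase s _ hus, add_sub_cancel_right] at this
  have h2 : ∀ u : H, rankOne ℂ u u ∈ auxW H k := by
    intro u
    by_cases hu : u = 0
    · subst hu; simp
    have hn : (‖u‖ : ℂ) ≠ 0 := by simpa using hu
    have h3 := h1 ((‖u‖ : ℂ)⁻¹ • u) (by rw [norm_smul, norm_inv]; simp [hu])
    rw [map_smulₛₗ, map_smul] at h3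
    simp only [smul_apply] at h3
    rwa [Submodule.smul_mem_iff, Submodule.smul_mem_iff] at h3
    · exact inv_ne_zero hn
    · simpa using hu
  have e : rankOne ℂ x y = (1/4 : ℂ) • (rankOne ℂ (x + y) (x + y) - rankOne ℂ (x - y) (x - y)
      + Complex.I • rankOne ℂ (x + Complex.I • y) (x + Complex.I • y)
      - Complex.I • rankOne ℂ (x - Complex.I • y) (x - Complex.I • y)) := by
    have hI := Complex.I_mul_I
    ext z
    simp only [rankOne_apply, smul_apply, sub_apply,
      add_apply, inner_add_left, inner_sub_left, inner_smul_left, Complex.conj_I]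
    match_scalars <;> ring_nf <;> simp only [Complex.I_sq] <;> ring
  rw [e]
  refine Submodule.smul_mem _ _ (Submodule.sub_mem _ (Submodule.add_mem _ (Submodule.sub_mem _ (h2 _) (h2 _))
    (Submodule.smul_mem _ _ (h2 _))) (Submodule.smul_mem _ _ (h2 _)))

theorem aux_rankProj_compact (k : ℕ) (P : H →L[ℂ] H) (hP : IsRankProj k P) : IsCompactOperator P := by
  have hfd : FiniteDimensional ℂ (LinearMap.range (P : H →ₗ[ℂ] H)) := by
    rw [FiniteDimensional, ← Module.rank_lt_aleph0_iff, hP.2.2]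
    exact Cardinal.natCast_lt_aleph0
  let U := LinearMap.range (P : H →ₗ[ℂ] H)
  let P' : H →L[ℂ] U := P.codRestrict U (fun x => ⟨x, rfl⟩)
  have : FiniteDimensional ℂ U := hfd
  have : ProperSpace U := FiniteDimensional.proper ℂ U
  have : IsCompactOperator P' := isCompactOperator_of_locallyCompactSpace_dom P'
  exact this.clm_comp U.subtypeL

open InnerProductSpace in
theorem aux_compact_mem_closure (k : ℕ) (hk : 0 < k) (hkdim : (k : Cardinal) < Module.rank ℂ H)
    (a : H →L[ℂ] H) (ha : IsCompactOperator a) : a ∈ (auxW H k).topologicalClosure := by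
  rw [← SetLike.mem_coe, Submodule.topologicalClosure_coe, Metric.mem_closure_iff]
  intro ε hε
  have htb := (ha.isCompact_closure_image_closedBall (f := (a : H →ₗ[ℂ] H)) 1).totallyBounded
  obtain ⟨t, ht, hcov⟩ := Metric.totallyBounded_iff.mp htb (ε/2) (by positivity)
  let U := Submodule.span ℂ t
  have : FiniteDimensional ℂ U := FiniteDimensional.span_of_finite ℂ ht
  refine ⟨U.starProjection * a, ?_, ?_⟩
  · rw [(stdOrthonormalBasis ℂ U).starProjection_eq_sum_rankOne, Finset.sum_mul]
    refine Submodule.sum_mem _ fun i _ => ?_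
    rw [ContinuousLinearMap.mul_def, rankOne_comp]
    exact aux_rankOne_mem k hk hkdim _ _
  · rw [dist_eq_norm]
    refine lt_of_le_of_lt ?_ (half_lt_self hε)
    refine ContinuousLinearMap.opNorm_le_of_unit_norm (by positivity) ?_
    intro x hx
    have hm : a x ∈ closure ((a : H →ₗ[ℂ] H) '' Metric.closedBall 0 1) :=
      subset_closure ⟨x, by simp [hx], rfl⟩
    have := hcov hm
    simp only [Set.mem_iUnion, Metric.mem_ball, exists_prop] at this
    obtain ⟨y, hy, hd⟩ := this
    have h1 : ‖a x - U.starProjection (a x)‖ ≤ ‖a x - y‖ := by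
      rw [Submodule.starProjection_minimal]
      exact ciInf_le ⟨0, by rintro _ ⟨z, rfl⟩; positivity⟩ (⟨y, Submodule.subset_span hy⟩ : U)
    rw [dist_eq_norm] at hd
    simpa using h1.trans hd.le

theorem aux_limit (X Y : H →L[ℂ] H) (h : ∀ t : ℝ, 0 ≤ (t^2) • X + t • Y) : Y = 0 := by
  have key : ∀ (Z : H →L[ℂ] H), (∀ t : ℝ, 0 ≤ (t^2) • X + t • Z) → 0 ≤ Z := by
    intro Z hZ
    have h1 : ∀ t : ℝ, 0 < t → 0 ≤ t • X + Z := by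
      intro t ht
      have := smul_nonneg (inv_nonneg.mpr ht.le) (hZ t)
      rw [smul_add, smul_smul, smul_smul, inv_mul_cancel₀ ht.ne', one_smul] at this
      rwa [show t⁻¹ * t^2 = t by field_simp] at this
    have h2 : Filter.Tendsto (fun t : ℝ => t • X + Z) (nhdsWithin 0 (Set.Ioi 0)) (nhds Z) := by
      have : Continuous (fun t : ℝ => t • X + Z) := by fun_prop
      have := (this.tendsto 0)
      simp only [zero_smul, zero_add] at this
      exact this.mono_left nhdsWithin_le_nhds
    exact ge_of_tendsto h2 (Filter.eventually_of_mem self_mem_nhdsWithin fun t ht => h1 t ht)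
  refine le_antisymm ?_ (key Y h)
  have := key (-Y) (fun t => by simpa using h (-t))
  simpa using this

theorem aux_mul_zero (T Q : H →L[ℂ] H) (hT : 0 ≤ T) (hQ : IsSelfAdjoint Q) (h : Q * T * Q = 0) :
    T * Q = 0 ∧ Q * T = 0 := by
  have h0 : T * Q = 0 := by
    obtain ⟨s, rfl⟩ := CStarAlgebra.nonneg_iff_eq_star_mul_self.mp hT
    have : star (s * Q) * (s * Q) = 0 := by
      rw [star_mul, hQ.star_eq, ← h]; noncomm_ring
    rw [mul_assoc, (CStarRing.star_mul_self_eq_zero_iff _).mp this, mul_zero]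
  refine ⟨h0, ?_⟩
  have := congrArg star h0
  simpa [hQ.star_eq, (IsSelfAdjoint.of_nonneg hT).star_eq] using this

theorem aux_corner_s4 (f : (H →L[ℂ] H) →ₗ[ℂ] (H →L[ℂ] H)) (hf : ∀ a, 0 ≤ a → 0 ≤ f a)
    (P Q : H →L[ℂ] H) (hPs : IsSelfAdjoint P) (hP : P * P = P) (hQs : IsSelfAdjoint Q)
    (hQ : Q * Q = Q) (hPQ : f P = Q) (h1 : f 1 = 1) (b : H →L[ℂ] H) (hb : 0 ≤ b) :
    f ((1-P) * b * (1-P)) * Q = 0 ∧ Q * f ((1-P) * b * (1-P)) = 0 ∧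
      Q * f (P * b * (1-P) + (1-P) * b * P) * Q = 0 := by
  have hRs : IsSelfAdjoint (1 - P) := (IsSelfAdjoint.one _).sub hPs
  have hR : (1 - P) * (1 - P) = 1 - P := by rw [mul_sub, sub_mul, sub_mul, hP]; simp
  have hT : 0 ≤ f ((1-P) * b * (1-P)) := hf _ (hRs.conjugate_nonneg hb)
  have hle : b ≤ (‖b‖ : ℝ) • (1 : H →L[ℂ] H) := by
    have := IsSelfAdjoint.le_algebraMap_norm_self (a := b) (IsSelfAdjoint.of_nonneg hb)
    rwa [Algebra.algebraMap_eq_smul_one] at this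
  have hle2 : 0 ≤ (‖b‖ : ℝ) • (1 - P) - (1-P) * b * (1-P) := by
    have := hRs.conjugate_nonneg (sub_nonneg.mpr hle)
    rw [mul_sub (1 - P), sub_mul ((1 - P) * _), mul_smul_comm, mul_one, smul_mul_assoc, hR] at this
    exact this
  have hle3 := hf _ hle2
  have hfR : f ((‖b‖ : ℝ) • (1 - P)) = (‖b‖ : ℝ) • (1 - Q) := by
    rw [← hPQ, ← h1, ← map_sub, h1, ← Complex.coe_smul, map_smul, Complex.coe_smul]
  rw [map_sub, hfR] at hle3
  have hz : Q * f ((1-P) * b * (1-P)) * Q = 0 := by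
    refine le_antisymm ?_ (hQs.conjugate_nonneg hT)
    have := hQs.conjugate_nonneg hle3
    have e : Q * (1 - Q) = 0 := by rw [mul_sub, hQ]; simp
    rw [mul_sub, sub_mul, mul_smul_comm, e, smul_zero, zero_mul, zero_sub] at this
    simpa using this
  obtain ⟨z1, z2⟩ := aux_mul_zero _ _ hT hQs hz
  refine ⟨z1, z2, ?_⟩
  apply aux_limit (Q * f (P * b * P) * Q)
  intro t
  have hs : IsSelfAdjoint (t • P + (1 - P)) := by
    refine IsSelfAdjoint.add ?_ hRs
    exact IsSelfAdjoint.smul (IsSelfAdjoint.all t) hPs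
  have h3 := hQs.conjugate_nonneg (hf _ (hs.conjugate_nonneg hb))
  have e : (t • P + (1 - P)) * b * (t • P + (1 - P)) =
      ((t^2 : ℝ) : ℂ) • (P * b * P) + (t : ℂ) • (P * b * (1-P) + (1-P) * b * P) + (1-P) * b * (1-P) := by
    rw [Complex.coe_smul, Complex.coe_smul]
    simp only [add_mul, mul_add, smul_mul_assoc, mul_smul_comm, smul_smul, smul_add, pow_two]
    abel
  rw [e, map_add, map_add, map_smul, map_smul, Complex.coe_smul, Complex.coe_smul, mul_add, z2,
    add_zero, mul_add, add_mul, mul_smul_comm, smul_mul_assoc, mul_smul_comm, smul_mul_assoc] at h3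
  exact h3

theorem aux_proj_jordan (f : (H →L[ℂ] H) →ₗ[ℂ] (H →L[ℂ] H)) (hf : ∀ a, 0 ≤ a → 0 ≤ f a)
    (h1 : f 1 = 1) (P Q : H →L[ℂ] H) (hPs : IsSelfAdjoint P) (hP : P * P = P)
    (hQs : IsSelfAdjoint Q) (hQ : Q * Q = Q) (hPQ : f P = Q) (b : H →L[ℂ] H) :
    f (P * b + b * P) = Q * f b + f b * Q := by
  have hb : b ∈ Submodule.span ℂ {a : H →L[ℂ] H | 0 ≤ a} := by
    rw [CStarAlgebra.span_nonneg]; trivial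
  induction hb using Submodule.span_induction with
  | zero => simp
  | add x y _ _ hx hy =>
    rw [show P * (x + y) + (x + y) * P = (P * x + x * P) + (P * y + y * P) by noncomm_ring,
      map_add, hx, hy, map_add]
    noncomm_ring
  | smul c x _ hx =>
    rw [mul_smul_comm, smul_mul_assoc, ← smul_add, map_smul, hx, map_smul, smul_add, mul_smul_comm, smul_mul_assoc]
  | mem b hb =>
    have hRs : IsSelfAdjoint (1 - P) := (IsSelfAdjoint.one _).sub hPs
    have hR : (1 - P) * (1 - P) = 1 - P := by rw [mul_sub, sub_mul, sub_mul, hP]; simp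
    have hSs : IsSelfAdjoint (1 - Q) := (IsSelfAdjoint.one _).sub hQs
    have hS : (1 - Q) * (1 - Q) = 1 - Q := by rw [mul_sub, sub_mul, sub_mul, hQ]; simp
    obtain ⟨a1, a2, a3⟩ := aux_corner_s4 f hf P Q hPs hP hQs hQ hPQ h1 b hb
    obtain ⟨b1, b2, b3⟩ := aux_corner_s4 f hf (1-P) (1-Q) hRs hR hSs hS (by rw [map_sub, h1, hPQ]) h1 b hb
    rw [sub_sub_cancel] at b1 b2 b3
    rw [add_comm (_ * P)] at b3
    set T1 := f ((1-P) * b * (1-P))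
    set T2 := f (P * b * P)
    set c := f (P * b * (1-P) + (1-P) * b * P)
    have e1 : f (P * b + b * P) = T2 + T2 + c := by
      rw [← map_add, ← map_add]; congr 1; noncomm_ring
    have e2 : f b = T1 + T2 + c := by
      rw [← map_add, ← map_add]; congr 1; noncomm_ring
    rw [e1, e2]
    have c1 : T2 * Q = T2 := by rw [mul_sub, mul_one, sub_eq_zero] at b1; exact b1.symm
    have c2 : Q * T2 = T2 := by rw [sub_mul, one_mul, sub_eq_zero] at b2; exact b2.symm
    have c3 : c = Q * c + c * Q := by
      have : (1 - Q) * c * (1 - Q) = c - (Q * c + c * Q) + Q * c * Q := by noncomm_ring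
      rw [b3, a3, add_zero] at this
      exact sub_eq_zero.mp this.symm
    simp only [mul_add, add_mul, a1, a2, c1, c2]
    rw [show T2 + T2 + c = T2 + T2 + (Q * c + c * Q) by rw [← c3]]
    abel

theorem aux_union {M : Type*} [AddCommGroup M] (K : AddSubgroup M) (p q : M → Prop)
    (hp : ∀ x y, p x → p y → p (x - y)) (hq : ∀ x y, q x → q y → q (x - y))
    (h : ∀ x ∈ K, p x ∨ q x) : (∀ x ∈ K, p x) ∨ (∀ x ∈ K, q x) := by
  by_contra hcon
  push Not at hcon
  obtain ⟨⟨x, hx, hpx⟩, ⟨y, hy, hqy⟩⟩ := hcon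
  have hqx := (h x hx).resolve_left hpx
  have hpy := (h y hy).resolve_right hqy
  rcases h (x + y) (K.add_mem hx hy) with h1 | h1
  · exact hpx (by simpa using hp _ _ h1 hpy)
  · exact hqy (by simpa using hq _ _ h1 hqx)

open InnerProductSpace in
theorem aux_prime (u v : H →L[ℂ] H)
    (h : ∀ x y : H, u * rankOne ℂ x y * v + v * rankOne ℂ x y * u = 0) : u = 0 ∨ v = 0 := by
  have h1 : ∀ x : H, u x = 0 ∨ v x = 0 := by
    intro x
    by_contra hcon
    push Not at hcon
    obtain ⟨hu, hv⟩ := hcon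
    have h2 := congrArg (fun T : H →L[ℂ] H => T x) (h x (u x))
    simp only [add_apply, mul_apply_eq_comp, rankOne_apply, map_smul,
      zero_apply] at h2
    have h3 := congrArg (fun z => inner ℂ (u x) z) h2
    simp only [inner_add_right, inner_smul_right, inner_zero_right] at h3
    have hne : inner ℂ (u x) (u x) ≠ 0 := inner_self_ne_zero.mpr hu
    have h4 : inner ℂ (u x) (v x) = 0 := by
      have : (2 * inner ℂ (u x) (u x)) * inner ℂ (u x) (v x) = 0 := by linear_combination h3
      exact (mul_eq_zero.mp this).resolve_left (by simpa using hu)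
    rw [h4, zero_smul, zero_add, smul_eq_zero] at h2
    exact h2.elim hne hv
  rcases aux_union (⊤ : AddSubgroup H) (fun x => u x = 0) (fun x => v x = 0)
    (fun x y hx hy => by simp [hx, hy]) (fun x y hx hy => by simp [hx, hy])
    (fun x _ => h1 x) with h | h
  · left; ext x; simpa using h x trivial
  · right; ext x; simpa using h x trivial

theorem aux_two {M : Type*} [AddCommGroup M] [Module ℂ M] {x y : M} (h : x + x = y + y) : x = y := by
  have : (2 : ℂ) • x = (2 : ℂ) • y := by rw [two_smul, two_smul, h]
  exact smul_right_injective M (two_ne_zero) this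

theorem aux_sq (f : (H →L[ℂ] H) →ₗ[ℂ] (H →L[ℂ] H)) (K : Submodule ℂ (H →L[ℂ] H))
    (hJ : ∀ a ∈ K, ∀ b, f (a * b + b * a) = f a * f b + f b * f a)
    (a : H →L[ℂ] H) (ha : a ∈ K) : f (a * a) = f a * f a := by
  have := hJ a ha a
  rw [map_add] at this
  exact aux_two this

theorem aux_triple (f : (H →L[ℂ] H) →ₗ[ℂ] (H →L[ℂ] H)) (K : Submodule ℂ (H →L[ℂ] H))
    (hKr : ∀ a b, a ∈ K → a * b ∈ K)
    (hJ : ∀ a ∈ K, ∀ b, f (a * b + b * a) = f a * f b + f b * f a)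
    (a b : H →L[ℂ] H) (ha : a ∈ K) : f (a * b * a) = f a * f b * f a := by
  have h1 := hJ a ha (a * b + b * a)
  rw [hJ a ha b] at h1
  have h2 := hJ (a * a) (hKr _ _ ha) b
  rw [aux_sq f K hJ a ha] at h2
  apply aux_two
  rw [← map_add]
  rw [show a * b * a + a * b * a = (a * (a * b + b * a) + (a * b + b * a) * a) -
    (a * a * b + b * (a * a)) by noncomm_ring, map_sub, h1, h2]
  noncomm_ring

theorem aux_triple2 (f : (H →L[ℂ] H) →ₗ[ℂ] (H →L[ℂ] H)) (K : Submodule ℂ (H →L[ℂ] H))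
    (hKr : ∀ a b, a ∈ K → a * b ∈ K)
    (hJ : ∀ a ∈ K, ∀ b, f (a * b + b * a) = f a * f b + f b * f a)
    (a b c : H →L[ℂ] H) (ha : a ∈ K) (hc : c ∈ K) :
    f (a * b * c + c * b * a) = f a * f b * f c + f c * f b * f a := by
  have h1 := aux_triple f K hKr hJ (a + c) b (K.add_mem ha hc)
  have h2 := aux_triple f K hKr hJ a b ha
  have h3 := aux_triple f K hKr hJ c b hc
  rw [show a * b * c + c * b * a = (a + c) * b * (a + c) - a * b * a - c * b * c by noncomm_ring,
    map_sub, map_sub, h1, h2, h3, map_add]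
  noncomm_ring

open InnerProductSpace in
theorem aux_each (f : (H →L[ℂ] H) →ₗ[ℂ] (H →L[ℂ] H)) (K : Submodule ℂ (H →L[ℂ] H))
    (hKr : ∀ a b, a ∈ K → a * b ∈ K)
    (hJ : ∀ a ∈ K, ∀ b, f (a * b + b * a) = f a * f b + f b * f a)
    (honto : ∀ x y : H, ∃ r ∈ K, f r = rankOne ℂ x y)
    (a b : H →L[ℂ] H) (ha : a ∈ K) (hb : b ∈ K) :
    f (a * b) = f a * f b ∨ f (a * b) = f b * f a := by
  rw [← sub_eq_zero (a := f (a * b)), ← sub_eq_zero (a := f (a * b)) (b := f b * f a)]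
  apply aux_prime
  intro x y
  obtain ⟨r, hr, hrxy⟩ := honto x y
  rw [← hrxy]
  have h1 := aux_triple2 f K hKr hJ (a * b) r (b * a) (hKr _ _ ha) (hKr _ _ hb)
  have h2 := aux_triple f K hKr hJ a (b * r * b) ha
  rw [aux_triple f K hKr hJ b r hb] at h2
  have h3 := aux_triple f K hKr hJ b (a * r * a) hb
  rw [aux_triple f K hKr hJ a r ha] at h3
  have h4 : f (b * a) = f a * f b + f b * f a - f (a * b) := by
    rw [← hJ a ha b, map_add]; abel
  have h5 : a * b * r * (b * a) + b * a * r * (a * b) =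
    a * (b * r * b) * a + b * (a * r * a) * b := by noncomm_ring
  rw [h5, map_add, h2, h3, h4] at h1
  have h6 := sub_eq_zero.mpr h1
  rw [← h6]
  noncomm_ring

open InnerProductSpace in
theorem aux_hom_or_anti (f : (H →L[ℂ] H) →ₗ[ℂ] (H →L[ℂ] H)) (K : Submodule ℂ (H →L[ℂ] H))
    (hKr : ∀ a b, a ∈ K → a * b ∈ K)
    (hJ : ∀ a ∈ K, ∀ b, f (a * b + b * a) = f a * f b + f b * f a)
    (honto : ∀ x y : H, ∃ r ∈ K, f r = rankOne ℂ x y) :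
    (∀ a ∈ K, ∀ b ∈ K, f (a * b) = f a * f b) ∨ (∀ a ∈ K, ∀ b ∈ K, f (a * b) = f b * f a) := by
  apply aux_union K.toAddSubgroup (fun a => ∀ b ∈ K, f (a * b) = f a * f b)
    (fun a => ∀ b ∈ K, f (a * b) = f b * f a)
  · intro x y hx hy b hb
    rw [sub_mul, map_sub, map_sub, hx b hb, hy b hb, sub_mul]
  · intro x y hx hy b hb
    rw [sub_mul, map_sub, map_sub, hx b hb, hy b hb, mul_sub]
  · intro a ha
    apply aux_union K.toAddSubgroup (fun b => f (a * b) = f a * f b)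
      (fun b => f (a * b) = f b * f a)
    · intro x y hx hy
      rw [mul_sub, map_sub, map_sub, hx, hy, mul_sub]
    · intro x y hx hy
      rw [mul_sub, map_sub, map_sub, hx, hy, sub_mul]
    · intro b hb
      exact aux_each f K hKr hJ honto a b ha hb


open InnerProductSpace in
theorem aux_norm_le (f : (H →L[ℂ] H) →ₗ[ℂ] (H →L[ℂ] H)) (K : Submodule ℂ (H →L[ℂ] H))
    (hKr : ∀ a b, a ∈ K → a * b ∈ K)
    (hKs : ∀ a ∈ K, star a ∈ K) (hstar : ∀ a, f (star a) = star (f a))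
    (hKone : ∀ x y : H, rankOne ℂ x y ∈ K)
    (hJ : ∀ a ∈ K, ∀ b, f (a * b + b * a) = f a * f b + f b * f a)
    (hor : (∀ a ∈ K, ∀ b ∈ K, f (a * b) = f a * f b) ∨ (∀ a ∈ K, ∀ b ∈ K, f (a * b) = f b * f a))
    (hne : ∀ x : H, ‖x‖ = 1 → f (rankOne ℂ x x) ≠ 0) (a : H →L[ℂ] H) (ha : a ∈ K) :
    ‖a‖ ≤ ‖f a‖ := by
  have hn : ‖f (star a * a)‖ = ‖f a‖ * ‖f a‖ := by
    rcases hor with h | h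
    · rw [h _ (hKs a ha) _ ha, hstar, CStarRing.norm_star_mul_self]
    · rw [h _ (hKs a ha) _ ha, hstar, CStarRing.norm_self_mul_star]
  refine ContinuousLinearMap.opNorm_le_of_unit_norm (norm_nonneg _) ?_
  intro x hx
  have he := hne x hx
  set e := rankOne ℂ x x with hedef
  have hee : e * e = e := isIdempotentElem_rankOne_self hx
  have hes : star e = e := by
    rw [ContinuousLinearMap.star_eq_adjoint]; exact adjoint_rankOne x x
  have hne1 : ‖f e‖ = 1 := by
    have h1 : star (f e) * f e = f e := by
      rw [← hstar, hes, ← aux_sq f K hJ e (hKone _ _), hee]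
    have h2 := CStarRing.norm_star_mul_self (x := f e)
    rw [h1] at h2
    have h3 : ‖f e‖ ≠ 0 := norm_ne_zero_iff.mpr he
    exact (mul_left_cancel₀ h3 (by rw [mul_one]; exact h2)).symm
  have h1 := aux_triple f K hKr hJ e (star a * a) (hKone _ _)
  have h2 : e * (star a * a) * e = ((‖a x‖ ^ 2 : ℝ) : ℂ) • e := by
    ext z
    simp only [hedef, mul_apply_eq_comp, rankOne_apply, map_smul, smul_apply,
      ContinuousLinearMap.star_eq_adjoint, ContinuousLinearMap.adjoint_inner_right,
      inner_self_eq_norm_sq_to_K]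
    rw [smul_comm, smul_smul, smul_smul]
    simp [mul_comm]
  rw [h2, map_smul] at h1
  have h3 := congrArg norm h1
  rw [norm_smul, hne1, mul_one] at h3
  have h4 : ‖f e * f (star a * a) * f e‖ ≤ ‖f a‖ * ‖f a‖ := by
    refine (norm_mul_le _ _).trans ?_
    rw [hne1, mul_one]
    refine (norm_mul_le _ _).trans ?_
    rw [hne1, one_mul, hn]
  rw [← h3, Complex.norm_real, Real.norm_of_nonneg (by positivity)] at h4
  exact abs_le_of_sq_le_sq' (by nlinarith) (norm_nonneg _) |>.2

open InnerProductSpace in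
theorem restriction_to_compacts_is_jordan
    (k : ℕ) (hk : 0 < k) (hkdim : (k : Cardinal) < Module.rank ℂ H)
    (φ : (H →L[ℂ] H) →ₗ[ℂ] (H →L[ℂ] H))
    (hpos : ∀ a : H →L[ℂ] H, a.IsPositive → (φ a).IsPositive)
    (hunital : φ 1 = 1)
    (honto : φ '' {P | IsRankProj k P} = {P | IsRankProj k P}) :
    (∀ a : H →L[ℂ] H, IsCompactOperator a → IsCompactOperator (φ a)) ∧
    Set.BijOn φ {a : H →L[ℂ] H | IsCompactOperator a}
      {a : H →L[ℂ] H | IsCompactOperator a} ∧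
    (∀ a : H →L[ℂ] H, IsCompactOperator a → φ (star a) = star (φ a)) ∧
    ((∀ a b : H →L[ℂ] H, IsCompactOperator a → IsCompactOperator b →
        φ (a * b) = φ a * φ b) ∨
     (∀ a b : H →L[ℂ] H, IsCompactOperator a → IsCompactOperator b →
        φ (a * b) = φ b * φ a)) := by
  have hpos' : ∀ a : H →L[ℂ] H, 0 ≤ a → 0 ≤ φ a := by
    intro a ha
    rw [ContinuousLinearMap.nonneg_iff_isPositive] at *
    exact hpos a ha
  let F : (H →L[ℂ] H) →ₚ[ℂ] (H →L[ℂ] H) := PositiveLinearMap.mk₀ φ hpos'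
  have hcont : Continuous φ := map_continuous F
  have hstar : ∀ a, φ (star a) = star (φ a) := fun a => map_star F a
  have hproj : ∀ P, IsRankProj k P → IsRankProj k (φ P) := by
    intro P hP
    have : φ P ∈ φ '' {P | IsRankProj k P} := ⟨P, hP, rfl⟩
    rw [honto] at this
    exact this
  let K : Submodule ℂ (H →L[ℂ] H) := (auxW H k).topologicalClosure
  have hWK : auxW H k ≤ K := Submodule.le_topologicalClosure _
  -- `K` is exactly the space of compact operators
  have hK : ∀ a, a ∈ K ↔ IsCompactOperator a := by
    intro a
    refine ⟨fun h => ?_, aux_compact_mem_closure k hk hkdim a⟩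
    have hle : K ≤ compactOperator (RingHom.id ℂ) H H := by
      refine Submodule.topologicalClosure_minimal _ ?_ isClosed_setOfPred_isCompactOperator
      refine Submodule.span_le.mpr ?_
      intro P hP
      exact aux_rankProj_compact k P hP
    exact hle h
  have hKl : ∀ a b, b ∈ K → a * b ∈ K := by
    intro a b hb
    rw [hK] at *
    exact hb.clm_comp a
  have hKr : ∀ a b, a ∈ K → a * b ∈ K := by
    intro a b ha
    rw [hK] at *
    exact ha.comp_clm b
  have hKs : ∀ a ∈ K, star a ∈ K := by
    intro a ha
    refine map_mem_closure (f := star) continuous_star ha ?_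
    intro x hx
    induction hx using Submodule.span_induction with
    | mem P hP => 
      refine Submodule.subset_span ?_
      have hP' : IsRankProj k P := hP
      rw [hP'.1.star_eq]; exact hP
    | zero => rw [star_zero]; exact Submodule.zero_mem _
    | add x y _ _ hx hy => rw [star_add]; exact Submodule.add_mem _ hx hy
    | smul c x _ hx => rw [star_smul]; exact Submodule.smul_mem _ _ hx
  have hKone : ∀ x y : H, rankOne ℂ x y ∈ K := fun x y => hWK (aux_rankOne_mem k hk hkdim x y)
  -- images
  have hmapW : (auxW H k).map φ = auxW H k := by
    rw [auxW, Submodule.map_span, honto]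
  have hmapK : ∀ a ∈ K, φ a ∈ K := by
    intro a ha
    refine map_mem_closure hcont ha ?_
    intro x hx
    have : φ x ∈ (auxW H k).map φ := ⟨x, hx, rfl⟩
    rw [hmapW] at this
    exact this
  have hJ : ∀ a ∈ K, ∀ b, φ (a * b + b * a) = φ a * φ b + φ b * φ a := by
    intro a ha b
    have hcl : IsClosed {a | φ (a * b + b * a) = φ a * φ b + φ b * φ a} :=
      isClosed_eq (by fun_prop) (by fun_prop)
    refine closure_minimal ?_ hcl ha
    intro x hx
    induction hx using Submodule.span_induction with
    | mem P hP =>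
      have hQ := hproj P hP
      exact aux_proj_jordan φ hpos' hunital P (φ P) hP.1 hP.2.1 hQ.1 hQ.2.1 rfl b
    | zero => simp
    | add x y _ _ hx hy =>
      simp only [Set.mem_ofPred_eq] at *
      rw [show (x + y) * b + b * (x + y) = (x * b + b * x) + (y * b + b * y) by noncomm_ring,
        map_add, hx, hy, map_add]
      noncomm_ring
    | smul c x _ hx =>
      simp only [Set.mem_ofPred_eq] at *
      rw [mul_smul_comm, smul_mul_assoc, ← smul_add, map_smul, hx, map_smul, smul_add,
        mul_smul_comm, smul_mul_assoc]
  have hsurj1 : ∀ x y : H, ∃ r ∈ K, φ r = rankOne ℂ x y := by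
    intro x y
    have := aux_rankOne_mem k hk hkdim x y
    rw [← hmapW] at this
    obtain ⟨r, hr, hrr⟩ := this
    exact ⟨r, hWK hr, hrr⟩
  have hor := aux_hom_or_anti φ K hKr hJ hsurj1
  have hne : ∀ x : H, ‖x‖ = 1 → φ (rankOne ℂ x x) ≠ 0 := by
    classical
    intro x hx h0
    have hall : ∀ y z : H, φ (rankOne ℂ y z) = 0 := by
      intro y z
      have e : rankOne ℂ y z = rankOne ℂ y x * (rankOne ℂ x x * rankOne ℂ x z) := by
        ext w
        simp [hx]
      rw [e]
      rcases hor with h | h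
      · rw [h _ (hKone _ _) _ (hKr _ _ (hKone _ _)), h _ (hKone _ _) _ (hKone _ _), h0]; simp
      · rw [h _ (hKone _ _) _ (hKr _ _ (hKone _ _)), h _ (hKone _ _) _ (hKone _ _), h0]; simp
    obtain ⟨s, hxs, hs, hc⟩ := aux_exists_finset k hkdim x hx
    have hP := aux_sum_isRankProj (s.erase x)
        (hs.comp (fun x : s.erase x => (⟨x, Finset.mem_of_mem_erase x.2⟩ : s)) (by
          intro x y hxy; ext; simpa using hxy))
    rw [Finset.card_erase_of_mem hxs, hc, Nat.add_sub_cancel] at hP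
    have hQ := (hproj _ hP).2.2
    rw [map_sum, Finset.sum_eq_zero (fun w _ => hall w w)] at hQ
    simp at hQ
    exact hk.ne' (by exact_mod_cast hQ.symm)
  have hnorm : ∀ a ∈ K, ‖a‖ ≤ ‖φ a‖ :=
    aux_norm_le φ K hKr hKs hstar hKone hJ hor hne
  have hclosed : IsClosed (φ '' (K : Set (H →L[ℂ] H))) := by
    let T : K →ₗ[ℂ] (H →L[ℂ] H) := φ.comp K.subtype
    have hT : AntilipschitzWith 1 T := by
      apply AddMonoidHomClass.antilipschitz_of_bound
      intro x
      simpa [T] using hnorm x x.2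
    have hKc : IsClosed (K : Set (H →L[ℂ] H)) := Submodule.isClosed_topologicalClosure _
    have : CompleteSpace K := hKc.completeSpace_coe
    have hTu : UniformContinuous T := by
      exact (uniformContinuous_addMonoidHom_of_continuous (f := (φ : (H →L[ℂ] H) →+ (H →L[ℂ] H))) hcont).comp
        uniformContinuous_subtype_val
    have h1 := hT.isClosed_range hTu
    suffices hE : φ '' (K : Set (H →L[ℂ] H)) = Set.range T by rw [hE]; exact h1
    ext y
    constructor
    · rintro ⟨x, hx, rfl⟩; exact ⟨⟨x, hx⟩, rfl⟩
    · rintro ⟨x, rfl⟩; exact ⟨x, x.2, rfl⟩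
  have hsurj : ∀ c ∈ K, ∃ a ∈ K, φ a = c := by
    intro c hc
    refine closure_minimal ?_ hclosed hc
    intro x hx
    have hx' : x ∈ auxW H k := hx
    rw [← hmapW] at hx'
    obtain ⟨r, hr, hrr⟩ := hx'
    exact ⟨r, hWK hr, hrr⟩
  simp only [← hK]
  refine ⟨hmapK, ⟨hmapK, ?_, ?_⟩, fun a _ => hstar a, ?_⟩
  · intro a ha b hb hab
    have := hnorm (a - b) (K.sub_mem ha hb)
    rw [map_sub, hab, sub_self, norm_zero] at this
    exact sub_eq_zero.mp (norm_le_zero_iff.mp this)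
  · intro c hc
    exact hsurj c hc
  · rcases hor with h | h
    · exact Or.inl fun a b ha hb => h a ha b hb
    · exact Or.inr fun a b ha hb => h a ha b hb
end

section
/- Let H be a complex Hilbert space, k a natural number with 0 < k < dim H, and let φ : B(H) → B(H) be a positive unital linear map which maps the set of rank-k orthogonal projections in B(H) onto itself. Then every vector state composed with φ is a vector state: for every unit vector x ∈ H there exists a unit vector y ∈ H such that ⟪φ(a) x, x⟫ = ⟪a y, y⟫ for all a ∈ B(H). -/
open scoped InnerProductSpace

variable {H : Type*} [NormedAddCommGroup H] [InnerProductSpace ℂ H] [CompleteSpace H]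

section Helpers
open scoped InnerProductSpace ComplexOrder

theorem exists_subspace (k : ℕ) (hkdim : (k : Cardinal) < Module.rank ℂ H) (n : ℕ) :
    ∀ (U : Submodule ℂ H), FiniteDimensional ℂ U → Module.finrank ℂ U + n = k →
    ∃ W : Submodule ℂ H, FiniteDimensional ℂ W ∧ U ≤ W ∧ Module.finrank ℂ W = k := by
  induction n with
  | zero => intro U hU h; exact ⟨U, hU, le_rfl, by simpa using h⟩
  | succ n ih =>
    intro U hU h
    have hne : U ≠ ⊤ := by
      rintro rfl
      have h1 : Module.rank ℂ H = (Module.finrank ℂ (⊤ : Submodule ℂ H) : Cardinal) := by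
        rw [Module.finrank_eq_rank, rank_top]
      rw [h1] at hkdim
      have := Nat.cast_lt.mp hkdim
      omega
    obtain ⟨z, -, hz⟩ := SetLike.exists_of_lt (lt_top_iff_ne_top.mpr hne)
    have hf : Module.finrank ℂ (U ⊔ (ℂ ∙ z) : Submodule ℂ H) = Module.finrank ℂ U + 1 := by
      have hd : U ⊓ (ℂ ∙ z) = ⊥ := by
        rw [← disjoint_iff, Submodule.disjoint_span_singleton]
        exact fun h => absurd h hz
      have := Submodule.finrank_sup_add_finrank_inf_eq U (ℂ ∙ z)
      rw [hd, finrank_bot, finrank_span_singleton (by rintro rfl; exact hz U.zero_mem)] at this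
      simpa using this
    obtain ⟨W, h1, h2, h3⟩ := ih (U ⊔ (ℂ ∙ z)) inferInstance (by omega)
    exact ⟨W, h1, le_sup_left.trans h2, h3⟩

theorem exists_proj (k : ℕ) (hkdim : (k : Cardinal) < Module.rank ℂ H) (F : Finset H)
    (hF : F.card ≤ k) : ∃ P : H →L[ℂ] H, IsRankProj k P ∧ ∀ z ∈ F, P z = z := by
  have hU : FiniteDimensional ℂ (Submodule.span ℂ (F : Set H)) := inferInstance
  have h1 : Module.finrank ℂ (Submodule.span ℂ (F : Set H)) ≤ k :=
    (finrank_span_finset_le_card F).trans hF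
  obtain ⟨W, h2, h3, h4⟩ := exists_subspace k hkdim (k - _) _ hU (Nat.add_sub_cancel' h1)
  refine ⟨W.starProjection, ⟨isSelfAdjoint_starProjection W, W.isIdempotentElem_starProjection, ?_⟩, ?_⟩
  · have : LinearMap.range (W.starProjection : H →ₗ[ℂ] H) = W := by
      simp
    rw [this, ← Module.finrank_eq_rank, h4]
  · intro z hz
    exact Submodule.starProjection_eq_self_iff.mpr (h3 (Submodule.subset_span hz))

theorem cs_right (f : (H →L[ℂ] H) →ₚ[ℂ] ℂ) (E a : H →L[ℂ] H) (hE : IsSelfAdjoint E)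
    (hE2 : E * E = E) (h0 : f E = 0) : f (a * E) = 0 ∧ f (E * a) = 0 := by
  have key : ‖f.toPreGNS E‖ = 0 := by
    rw [f.preGNS_norm_def]
    simp [hE.star_eq, hE2, h0]
  constructor
  · have := norm_inner_le_norm (𝕜 := ℂ) (f.toPreGNS (star a)) (f.toPreGNS E)
    rw [key, mul_zero, f.preGNS_inner_def] at this
    simpa using this
  · have := norm_inner_le_norm (𝕜 := ℂ) (f.toPreGNS E) (f.toPreGNS a)
    rw [key, zero_mul, f.preGNS_inner_def] at this
    simpa [hE.star_eq] using this

theorem f_compress (f : (H →L[ℂ] H) →ₚ[ℂ] ℂ) (Q a : H →L[ℂ] H) (hQ : IsSelfAdjoint Q)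
    (hQ2 : Q * Q = Q) (h0 : f (1 - Q) = 0) : f a = f (Q * a * Q) := by
  have hE : IsSelfAdjoint (1 - Q) := (IsSelfAdjoint.one _).sub hQ
  have hE2 : (1 - Q) * (1 - Q) = 1 - Q := by
    simp [mul_sub, sub_mul, hQ2]
  have h1 := (cs_right f (1 - Q) a hE hE2 h0).2
  have h2 := (cs_right f (1 - Q) (Q * a) hE hE2 h0).1
  have : a = (1 - Q) * a + Q * a * (1 - Q) + Q * a * Q := by noncomm_ring
  conv_lhs => rw [this]
  rw [map_add, map_add, h1, h2, zero_add, zero_add]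

theorem sum_rearrange {n m : ℕ} (g : Fin n → Fin n → Fin m → ℂ) :
    ∑ i, ∑ j, ∑ l, g i j l = ∑ l, ∑ j, ∑ i, g i j l := by
  have h1 : ∀ i, ∑ j, ∑ l, g i j l = ∑ l, ∑ j, g i j l := fun i => Finset.sum_comm
  simp_rw [h1]
  rw [Finset.sum_comm]
  exact Finset.sum_congr rfl fun l _ => Finset.sum_comm

theorem f_rep (f : (H →L[ℂ] H) →ₚ[ℂ] ℂ) (k : ℕ) (Q : H →L[ℂ] H) (hQ : IsRankProj k Q)
    (h0 : f (1 - Q) = 0) :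
    ∃ (m : ℕ) (w : Fin m → H), ∀ a : H →L[ℂ] H, f a = ∑ l, ⟪w l, a (w l)⟫_ℂ := by
  obtain ⟨hQs, hQ2, hr⟩ := hQ
  obtain ⟨_, hp⟩ := isStarProjection_iff_eq_starProjection_range.mp
    (⟨hQ2, hQs⟩ : IsStarProjection Q)
  have hfd : FiniteDimensional ℂ (LinearMap.range (Q : H →ₗ[ℂ] H)) := by
    apply Module.finite_of_rank_eq_nat hr
  let b := stdOrthonormalBasis ℂ (LinearMap.range (Q : H →ₗ[ℂ] H))
  let e : Fin (Module.finrank ℂ (LinearMap.range (Q : H →ₗ[ℂ] H))) → H := fun i => (b i : H)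
  have hQe : ∀ z, Q z = ∑ i, ⟪e i, z⟫_ℂ • e i := by
    intro z
    conv_lhs => rw [hp]
    rw [b.starProjection_eq_sum_rankOne]
    simp [e]
  have hc : ∀ a : H →L[ℂ] H, Q * a * Q =
      ∑ i, ∑ j, ⟪e i, a (e j)⟫_ℂ • InnerProductSpace.rankOne ℂ (e i) (e j) := by
    intro a
    ext z
    simp only [mul_apply_eq_comp, hQe, map_sum, map_smul, inner_sum, inner_smul_right,
      sum_apply, smul_apply,
      InnerProductSpace.rankOne_apply, Finset.smul_sum, smul_smul]
    rw [Finset.sum_comm]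
    refine Finset.sum_congr rfl fun i _ => Finset.sum_congr rfl fun j _ => ?_
    rw [mul_comm]
  let M : Matrix _ _ ℂ := Matrix.of fun i j => f (InnerProductSpace.rankOne ℂ (e i) (e j))
  have hM : M.PosSemidef := by
    apply Matrix.PosSemidef.of_dotProduct_mulVec_nonneg
    · ext i j
      simp only [M, Matrix.conjTranspose_apply, Matrix.of_apply]
      rw [← map_star f, ContinuousLinearMap.star_eq_adjoint, InnerProductSpace.adjoint_rankOne]
    · intro c
      have h1 : 0 ≤ f (InnerProductSpace.rankOne ℂ (∑ i, star (c i) • e i) (∑ i, star (c i) • e i)) :=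
        f.map_nonneg ((ContinuousLinearMap.nonneg_iff_isPositive _).mpr
          (InnerProductSpace.isPositive_rankOne_self _))
      convert h1 using 1
      simp only [map_sum, map_smulₛₗ, sum_apply, smul_apply,
        dotProduct, Matrix.mulVec, M, Matrix.of_apply, Pi.star_apply, smul_eq_mul, Finset.mul_sum]
      rw [Finset.sum_comm]
      simp
      refine Finset.sum_congr rfl fun i _ => Finset.sum_congr rfl fun j _ => ?_
      ring
  obtain ⟨m, v, hv⟩ := Matrix.posSemidef_iff_eq_sum_vecMulVec.mp hM
  refine ⟨m, fun l => ∑ i, star (v l i) • e i, fun a => ?_⟩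
  rw [f_compress f Q a hQs hQ2 h0, hc]
  simp only [map_sum, map_smul, inner_sum, sum_inner, inner_smul_left, inner_smul_right]
  have hMij : ∀ i j, f (InnerProductSpace.rankOne ℂ (e i) (e j)) = ∑ l, v l i * star (v l j) := by
    intro i j
    have := congrFun (congrFun hv i) j
    simpa [M, Matrix.sum_apply, Matrix.vecMulVec_apply] using this
  simp only [hMij, smul_eq_mul, Finset.mul_sum]
  rw [sum_rearrange]
  refine Finset.sum_congr rfl fun l _ => Finset.sum_congr rfl fun j _ =>
    Finset.sum_congr rfl fun i _ => ?_
  rw [Complex.star_def, Complex.conj_conj]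
  ring

theorem proj_norm (P : H →L[ℂ] H) (hP : IsSelfAdjoint P) (hP2 : P * P = P) (x : H) :
    ⟪x, (1 - P) x⟫_ℂ = ((‖x - P x‖ ^ 2 : ℝ) : ℂ) := by
  have h1 : ⟪P x, x - P x⟫_ℂ = 0 := by
    rw [← ContinuousLinearMap.adjoint_inner_right, ← ContinuousLinearMap.star_eq_adjoint,
      hP.star_eq, map_sub, ← mul_apply_eq_comp, hP2, sub_self, inner_zero_right]
  have h2 : ⟪x - P x, x - P x⟫_ℂ = ⟪x, x - P x⟫_ℂ := by
    rw [inner_sub_left, h1, sub_zero]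
  rw [sub_apply, one_apply_eq_self, ← h2,
    inner_self_eq_norm_sq_to_K]
  norm_cast

theorem rep_exists
    (k : ℕ) (hk : 0 < k) (hkdim : (k : Cardinal) < Module.rank ℂ H)
    (φ : (H →L[ℂ] H) →ₗ[ℂ] (H →L[ℂ] H))
    (hpos : ∀ a : H →L[ℂ] H, a.IsPositive → (φ a).IsPositive)
    (hunital : φ 1 = 1)
    (honto : φ '' {P | IsRankProj k P} = {P | IsRankProj k P})
    (x : H) : ∃ (m : ℕ) (w : Fin m → H),
    ∀ a : H →L[ℂ] H, ⟪x, φ a x⟫_ℂ = ∑ l, ⟪w l, a (w l)⟫_ℂ := by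
  let f : (H →L[ℂ] H) →ₚ[ℂ] ℂ := PositiveLinearMap.mk₀
    { toFun := fun a => ⟪x, φ a x⟫_ℂ
      map_add' := by intro a b; simp [inner_add_right]
      map_smul' := by intro c a; simp [inner_smul_right] }
    (fun a ha => (hpos a ((ContinuousLinearMap.nonneg_iff_isPositive _).mp ha)).inner_nonneg_right x)
  have hf : ∀ a, f a = ⟪x, φ a x⟫_ℂ := fun a => rfl
  obtain ⟨P, hP, hPx⟩ := exists_proj k hkdim {x} (by simpa using Nat.succ_le_of_lt hk)
  obtain ⟨Q, hQ, rfl⟩ := honto.ge hP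
  have h0 : f (1 - Q) = 0 := by
    rw [hf, map_sub, hunital, sub_apply, hPx x (by simp)]
    simp
  obtain ⟨m, w, h⟩ := f_rep f k Q hQ h0
  exact ⟨m, w, fun a => by rw [← hf, h]⟩

theorem fix_iff
    (k : ℕ) (φ : (H →L[ℂ] H) →ₗ[ℂ] (H →L[ℂ] H)) (hunital : φ 1 = 1)
    (honto : φ '' {P | IsRankProj k P} = {P | IsRankProj k P})
    (x : H) (m : ℕ) (w : Fin m → H)
    (hw : ∀ a : H →L[ℂ] H, ⟪x, φ a x⟫_ℂ = ∑ l, ⟪w l, a (w l)⟫_ℂ)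
    (Q : H →L[ℂ] H) (hQ : IsRankProj k Q) :
    φ Q x = x ↔ Submodule.span ℂ (Set.range w) ≤ LinearMap.range (Q : H →ₗ[ℂ] H) := by
  have hφQ : IsRankProj k (φ Q) := honto.le ⟨Q, hQ, rfl⟩
  have h1 := hw (1 - Q)
  rw [map_sub, hunital, proj_norm _ hφQ.1 hφQ.2.1] at h1
  simp only [proj_norm _ hQ.1 hQ.2.1] at h1
  have h2 : ‖x - φ Q x‖ ^ 2 = ∑ l, ‖w l - Q (w l)‖ ^ 2 := by exact_mod_cast h1
  have h3 : φ Q x = x ↔ ‖x - φ Q x‖ ^ 2 = 0 := by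
    rw [sq_eq_zero_iff, norm_eq_zero, sub_eq_zero, eq_comm]
  rw [h3, h2, Finset.sum_eq_zero_iff_of_nonneg (fun _ _ => by positivity), Submodule.span_le,
    Set.range_subset_iff]
  refine forall_congr' fun l => ?_
  simp only [Finset.mem_univ, true_imp_iff, SetLike.mem_coe]
  rw [sq_eq_zero_iff, norm_eq_zero, sub_eq_zero]
  constructor
  · intro h; exact ⟨w l, h.symm⟩
  · rintro ⟨y, hy⟩
    rw [← hy]
    change Q y = (Q * Q) y
    rw [hQ.2.1]

theorem main_aux
    (k : ℕ) (hk : 0 < k) (hkdim : (k : Cardinal) < Module.rank ℂ H)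
    (φ : (H →L[ℂ] H) →ₗ[ℂ] (H →L[ℂ] H))
    (hpos : ∀ a : H →L[ℂ] H, a.IsPositive → (φ a).IsPositive)
    (hunital : φ 1 = 1)
    (honto : φ '' {P | IsRankProj k P} = {P | IsRankProj k P})
    (x : H) (hx : ‖x‖ = 1) : ∃ y : H, ‖y‖ = 1 ∧
      ∀ a : H →L[ℂ] H, ⟪φ a x, x⟫_ℂ = ⟪a y, y⟫_ℂ := by
  choose m w hw using rep_exists k hk hkdim φ hpos hunital honto
  let S : H → Submodule ℂ H := fun z => Submodule.span ℂ (Set.range (w z))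
  have hfix : ∀ (z : H) (Q : H →L[ℂ] H), IsRankProj k Q →
      (φ Q z = z ↔ S z ≤ LinearMap.range (Q : H →ₗ[ℂ] H)) := fun z Q hQ =>
    fix_iff k φ hunital honto z (m z) (w z) (hw z) Q hQ
  have hfin : ∀ F : Finset H, FiniteDimensional ℂ (⨆ z ∈ F, S z : Submodule ℂ H) := by
    intro F
    have : ∀ z, FiniteDimensional ℂ (S z) := fun z =>
      FiniteDimensional.span_of_finite ℂ (Set.finite_range _)
    exact Submodule.finiteDimensional_finset_sup F S |> fun h => by rwa [Finset.sup_eq_iSup] at h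
  have hQF : ∀ F : Finset H, F.card ≤ k → ∃ Q : H →L[ℂ] H, IsRankProj k Q ∧
      (⨆ z ∈ F, S z) ≤ LinearMap.range (Q : H →ₗ[ℂ] H) := by
    intro F hF
    obtain ⟨P, hP, hPx⟩ := exists_proj k hkdim F hF
    obtain ⟨Q, hQ, rfl⟩ := honto.ge hP
    exact ⟨Q, hQ, iSup₂_le fun z hz => (hfix z Q hQ).mp (hPx z hz)⟩
  have greedy : ∀ j, j + 1 ≤ k → ∃ F : Finset H, F.card ≤ j + 1 ∧
      Module.finrank ℂ (S x) + j ≤ Module.finrank ℂ (⨆ z ∈ F, S z : Submodule ℂ H) := by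
    classical
    intro j
    induction j with
    | zero => intro _; exact ⟨{x}, by simp, by rw [Finset.iSup_singleton]; simp⟩
    | succ j ih =>
      intro hj
      obtain ⟨F, hF, hd⟩ := ih (by omega)
      obtain ⟨Q, hQ, hle⟩ := hQF F (by omega)
      have hφQ : IsRankProj k (φ Q) := honto.le ⟨Q, hQ, rfl⟩
      have hz : ∃ z, φ Q z ≠ z := by
        by_contra! hall
        have h1 : LinearMap.range (φ Q : H →ₗ[ℂ] H) = ⊤ :=
          LinearMap.range_eq_top.mpr fun z => ⟨z, hall z⟩
        have h2 := hφQ.2.2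
        rw [h1, rank_top] at h2
        exact hkdim.ne h2.symm
      obtain ⟨z, hz⟩ := hz
      have hnl : ¬ S z ≤ ⨆ z ∈ F, S z := fun h => hz ((hfix z Q hQ).mpr (h.trans hle))
      refine ⟨insert z F, (Finset.card_insert_le _ _).trans (by omega), ?_⟩
      have := hfin (insert z F)
      have hlt : (⨆ z ∈ F, S z) < ⨆ y ∈ insert z F, S y := by
        rw [Finset.iSup_insert]
        exact right_lt_sup.mpr hnl
      have := Submodule.finrank_lt_finrank_of_lt hlt
      omega
  obtain ⟨F, hF, hd⟩ := greedy (k - 1) (by omega)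
  obtain ⟨Q, hQ, hle⟩ := hQF F (by omega)
  have hfd : FiniteDimensional ℂ (LinearMap.range (Q : H →ₗ[ℂ] H)) :=
    Module.finite_of_rank_eq_nat hQ.2.2
  have hk2 : Module.finrank ℂ (LinearMap.range (Q : H →ₗ[ℂ] H)) = k :=
    Module.finrank_eq_of_rank_eq hQ.2.2
  have h1 : Module.finrank ℂ (S x) ≤ 1 := by
    have := Submodule.finrank_mono hle
    omega
  have : FiniteDimensional ℂ (S x) := FiniteDimensional.span_of_finite ℂ (Set.finite_range _)
  obtain ⟨⟨y, hyS⟩, hy⟩ := finrank_le_one_iff.mp h1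
  have hc : ∀ l, ∃ c : ℂ, c • y = w x l := fun l => by
    obtain ⟨c, hc⟩ := hy ⟨w x l, Submodule.subset_span ⟨l, rfl⟩⟩
    exact ⟨c, congrArg Subtype.val hc⟩
  choose c hc using hc
  let s : ℝ := ∑ l, ‖c l‖ ^ 2
  have hs : 0 ≤ s := Finset.sum_nonneg fun _ _ => by positivity
  have hrep : ∀ a : H →L[ℂ] H, ⟪x, φ a x⟫_ℂ = s * ⟪y, a y⟫_ℂ := by
    intro a
    rw [hw x a]
    simp only [← hc, map_smul, inner_smul_left, inner_smul_right, s]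
    push_cast
    rw [Finset.sum_mul]
    refine Finset.sum_congr rfl fun l _ => ?_
    rw [← mul_assoc, Complex.mul_conj']
  have hrep2 : ∀ a : H →L[ℂ] H,
      ⟪x, φ a x⟫_ℂ = ⟪((√s : ℝ) : ℂ) • y, a (((√s : ℝ) : ℂ) • y)⟫_ℂ := by
    intro a
    rw [hrep, map_smul, inner_smul_left, inner_smul_right, Complex.conj_ofReal, ← mul_assoc,
      ← Complex.ofReal_mul, Real.mul_self_sqrt hs]
  refine ⟨((√s : ℝ) : ℂ) • y, ?_, fun a => ?_⟩
  · have h := hrep2 1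
    rw [hunital, one_apply_eq_self, one_apply_eq_self,
      inner_self_eq_norm_sq_to_K, inner_self_eq_norm_sq_to_K, hx] at h
    have h' : (1:ℝ) ^ 2 = ‖((√s : ℝ) : ℂ) • y‖ ^ 2 := by exact_mod_cast h
    have := norm_nonneg (((√s : ℝ) : ℂ) • y)
    nlinarith
  · rw [← inner_conj_symm, hrep2, inner_conj_symm]

end Helpers

theorem vector_state_comp_is_vector_state
    (k : ℕ) (hk : 0 < k) (hkdim : (k : Cardinal) < Module.rank ℂ H)
    (φ : (H →L[ℂ] H) →ₗ[ℂ] (H →L[ℂ] H))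
    (hpos : ∀ a : H →L[ℂ] H, a.IsPositive → (φ a).IsPositive)
    (hunital : φ 1 = 1)
    (honto : φ '' {P | IsRankProj k P} = {P | IsRankProj k P}) :
    ∀ x : H, ‖x‖ = 1 → ∃ y : H, ‖y‖ = 1 ∧
      ∀ a : H →L[ℂ] H, ⟪φ a x, x⟫_ℂ = ⟪a y, y⟫_ℂ := by
  intro x hx
  exact main_aux k hk hkdim φ hpos hunital honto x hx
end
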